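/- Let F : ℝ^n → ℝ^n be an everywhere defined real rational map whose Jacobian determinant vanishes nowhere on ℝ^n, let A(F) be the set of points at which F is not proper, and let B(F) = F^{-1}(A(F)). Then F(ℝ^n) is dense in ℝ^n if and only if the coimage ℝ^n \ F(ℝ^n) is contained in A(F). In that case, A(F) is the disjoint union of ℝ^n \ F(ℝ^n) and F(B(F)). If, furthermore, F has dense image but is not surjective, then both ℝ^n \ F(ℝ^n) and F(B(F)) are nonempty, so the coimage is a nonempty closed proper subset of A(F). -/

import Mathlib

/-- `F : ℝⁿ → ℝⁿ` is an everywhere defined real rational map. -/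
def IsEverywhereDefRatMap (n : ℕ) (F : (Fin n → ℝ) → (Fin n → ℝ)) : Prop :=
  ∀ i : Fin n, ∃ p q : MvPolynomial (Fin n) ℝ,
    (∀ x : Fin n → ℝ, MvPolynomial.eval x q ≠ 0) ∧
    ∀ x : Fin n → ℝ, F x i = MvPolynomial.eval x p / MvPolynomial.eval x q

/-- `F` is proper at a point `y` of the codomain: `y` has a compact neighborhood with
compact inverse image under `F`. -/
def ProperAt (n : ℕ) (F : (Fin n → ℝ) → (Fin n → ℝ)) (y : Fin n → ℝ) : Prop :=
  ∃ K : Set (Fin n → ℝ), K ∈ nhds y ∧ IsCompact K ∧ IsCompact (F ⁻¹' K)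

section
open scoped TensorProduct

/-- parity of the number of real points of a finite unramified real algebra -/
lemma count_unram (R : Type) [CommRing R] [Algebra ℝ R] [Module.Finite ℝ R]
    [Algebra.FormallyUnramified ℝ R] :
    Finite (R →ₐ[ℝ] ℝ) ∧ Nat.card (R →ₐ[ℝ] ℝ) ≡ Module.finrank ℝ R [MOD 2] := by
  classical
  have : Algebra.FormallyEtale ℂ (ℂ ⊗[ℝ] R) := Algebra.FormallyEtale.of_formallyUnramified_of_field _ _
  let e := Algebra.FormallyEtale.equivPiOfIsSepClosed ℂ (ℂ ⊗[ℝ] R)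
  have := Algebra.FormallyUnramified.finite_of_free ℂ (ℂ ⊗[ℝ] R)
  have : IsArtinianRing (ℂ ⊗[ℝ] R) := isArtinian_of_tower ℂ inferInstance
  have : Finite (PrimeSpectrum (ℂ ⊗[ℝ] R)) := inferInstance
  have h1 : Module.finrank ℝ R = Nat.card (PrimeSpectrum (ℂ ⊗[ℝ] R)) := by
    rw [← Module.finrank_baseChange (R := ℂ) (S := ℝ) (M' := R), e.toLinearEquiv.finrank_eq]
    have := Fintype.ofFinite (PrimeSpectrum (ℂ ⊗[ℝ] R))
    simp
  let e1 : PrimeSpectrum (ℂ ⊗[ℝ] R) ≃ ((PrimeSpectrum (ℂ ⊗[ℝ] R) → ℂ) →ₐ[ℂ] ℂ) :=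
    Equiv.ofBijective (fun s => Pi.evalAlgHom ℂ _ s) (by
      constructor
      · intro s t hst
        by_contra hne
        have := DFunLike.congr_fun hst (Pi.single s 1)
        simp [Ne.symm hne] at this
      · intro φ
        obtain ⟨s, hs⟩ := AlgHom.eq_piEvalAlgHom φ
        exact ⟨s, hs.symm⟩)
  let e2 : ((PrimeSpectrum (ℂ ⊗[ℝ] R) → ℂ) →ₐ[ℂ] ℂ) ≃ ((ℂ ⊗[ℝ] R) →ₐ[ℂ] ℂ) :=
    e.symm.arrowCongr AlgEquiv.refl
  let e3 : (R →ₐ[ℝ] ℂ) ≃ ((ℂ ⊗[ℝ] R) →ₐ[ℂ] ℂ) := AlgHom.liftEquiv ℝ ℂ R ℂ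
  let e4 := (e1.trans e2).trans e3.symm
  have : Finite (R →ₐ[ℝ] ℂ) := Finite.of_equiv _ e4
  have := Fintype.ofFinite (R →ₐ[ℝ] ℂ)
  rw [h1, Nat.card_congr e4]
  let f : Function.End (R →ₐ[ℝ] ℂ) := fun φ => (Complex.conjAe : ℂ →ₐ[ℝ] ℂ).comp φ
  have hf : f ^ 2 ^ 1 = 1 := by
    rw [pow_one, pow_two]
    funext φ
    ext x
    change star (star (φ x)) = φ x
    simp
  have := Equiv.Perm.card_fixedPoints_modEq hf
  let e5 : (R →ₐ[ℝ] ℝ) ≃ f.fixedPoints := Equiv.ofBijective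
    (fun φ => ⟨Complex.ofRealAm.comp φ, by
      apply AlgHom.ext; intro x; simp [f]⟩) (by
    constructor
    · intro φ ψ h
      ext x
      have := DFunLike.congr_fun (Subtype.ext_iff.1 h) x
      simpa using this
    · rintro ⟨φ, hφ⟩
      have h0 : ∀ x, ((φ x).re : ℂ) = φ x := fun x => by
        have := DFunLike.congr_fun (hφ : f φ = φ) x
        simp [f] at this
        exact Complex.conj_eq_iff_re.1 this
      refine ⟨⟨⟨⟨⟨fun x => (φ x).re, by simp⟩, ?_⟩, by simp, by simp⟩, ?_⟩, ?_⟩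
      · intro x y
        apply Complex.ofReal_injective
        simp only [Complex.ofReal_mul, h0]
        rw [map_mul]
      · intro r
        simp
      · apply Subtype.ext
        apply AlgHom.ext
        intro x
        exact h0 x)
  have : Finite (R →ₐ[ℝ] ℝ) := Finite.of_equiv _ e5.symm
  refine ⟨this, ?_⟩
  rw [Nat.card_congr e5, Nat.card_eq_fintype_card, Nat.card_eq_fintype_card]
  exact (Equiv.Perm.card_fixedPoints_modEq hf).symm
end

section
open scoped TensorProduct

lemma clear_denom {B C : Type} [CommRing B] [IsDomain B] [CommRing C] [Algebra B C]
    {ι : Type} [Fintype ι] (c : ι → C)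
    (hc : Submodule.span (FractionRing B) (Set.range fun i => (1 : FractionRing B) ⊗ₜ[B] c i) = ⊤) (z : C) :
    ∃ q : B, q ≠ 0 ∧ q • z ∈ Submodule.span B (Set.range c) := by
  classical
  have h1 : (1 : FractionRing B) ⊗ₜ[B] z ∈
      Submodule.span (FractionRing B) (Set.range fun i => (1 : FractionRing B) ⊗ₜ[B] c i) := by
    rw [hc]; trivial
  obtain ⟨k, hk⟩ := (Submodule.mem_span_range_iff_exists_fun _).1 h1
  obtain ⟨q, hq⟩ := IsLocalization.exist_integer_multiples_of_finset (nonZeroDivisors B) (Finset.univ.image k)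
  have hq' : ∀ i, ∃ a : B, algebraMap B (FractionRing B) a = (q : B) • k i := fun i =>
    hq (k i) (by simp)
  choose a ha using hq'
  have h2 : TensorProduct.mk B (FractionRing B) C 1 ((q : B) • z) =
      TensorProduct.mk B (FractionRing B) C 1 (∑ i, a i • c i) := by
    simp only [map_smul, map_sum, TensorProduct.mk_apply]
    rw [← hk, Finset.smul_sum]
    refine Finset.sum_congr rfl fun i _ => ?_
    rw [← smul_assoc, ← ha i, algebraMap_smul]
  obtain ⟨r, hr⟩ := (IsLocalizedModule.eq_iff_exists (nonZeroDivisors B)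
    (TensorProduct.mk B (FractionRing B) C 1)).1 h2
  refine ⟨r * q, mul_ne_zero (nonZeroDivisors.coe_ne_zero r) (nonZeroDivisors.coe_ne_zero q), ?_⟩
  rw [mul_smul]
  have : (r : B) • (q : B) • z = (r : B) • ∑ i, a i • c i := hr
  rw [this]
  exact Submodule.smul_mem _ _ (Submodule.sum_mem _ fun i _ => Submodule.smul_mem _ _
    (Submodule.subset_span ⟨i, rfl⟩))

lemma gen_basis {B C : Type} [CommRing B] [IsDomain B] [CommRing C] [Algebra B C]
    [Algebra.FiniteType B C] [Module.Finite (FractionRing B) (FractionRing B ⊗[B] C)] :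
    ∃ Q : B, Q ≠ 0 ∧ Nonempty (Module.Basis (Fin (Module.finrank (FractionRing B) (FractionRing B ⊗[B] C)))
      (Localization.Away Q) (Localization.Away Q ⊗[B] C)) := by
  classical
  set K := FractionRing B
  have hs : Submodule.span K (Set.range fun x : C => (1 : K) ⊗ₜ[B] x) = ⊤ := by
    rw [eq_top_iff]
    rintro x -
    induction x with
    | zero => exact Submodule.zero_mem _
    | tmul a b =>
      have : a ⊗ₜ[B] b = a • ((1 : K) ⊗ₜ[B] b) := by simp [TensorProduct.smul_tmul']
      rw [this]
      exact Submodule.smul_mem _ _ (Submodule.subset_span ⟨b, rfl⟩)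
    | add x y hx hy => exact Submodule.add_mem _ hx hy
  obtain ⟨b, hb, hsp, hli⟩ := exists_linearIndependent K (Set.range fun x : C => (1 : K) ⊗ₜ[B] x)
  rw [hs] at hsp
  have : Finite b := hli.finite
  have := Fintype.ofFinite b
  have hch : ∀ i : b, ∃ x : C, (1 : K) ⊗ₜ[B] x = i := fun i => hb i.2
  choose c hc using hch
  have hfun : (fun i => (1 : K) ⊗ₜ[B] c i) = ((↑) : b → K ⊗[B] C) := funext hc
  have hspan : Submodule.span K (Set.range fun i => (1 : K) ⊗ₜ[B] c i) = ⊤ := by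
    rw [hfun, Subtype.range_coe]; exact hsp
  have hli' : LinearIndependent K (fun i => (1 : K) ⊗ₜ[B] c i) := by rw [hfun]; exact hli
  have hcard : Module.finrank K (K ⊗[B] C) = Fintype.card b :=
    Module.finrank_eq_card_basis (Module.Basis.mk hli' hspan.ge)
  obtain ⟨s, hs'⟩ := (inferInstance : Algebra.FiniteType B C).out
  let Z : Finset C := insert 1 (Finset.image₂ (· * ·) s (Finset.univ.image c))
  have hq := fun z => clear_denom c hspan z
  choose q hq0 hq using hq
  let Q := ∏ z ∈ Z, q z
  have hQ : ∀ z ∈ Z, Q • z ∈ Submodule.span B (Set.range c) := fun z hz => by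
    have : Q = (∏ z ∈ Z.erase z, q z) * q z := (Finset.prod_erase_mul _ _ hz).symm
    rw [this, mul_smul]
    exact Submodule.smul_mem _ _ (hq z)
  have hQ0 : Q ≠ 0 := Finset.prod_ne_zero_iff.2 fun z _ => hq0 z
  refine ⟨Q, hQ0, ?_⟩
  rw [hcard]
  set L := Localization.Away Q
  let N : Submodule L (L ⊗[B] C) := Submodule.span L (Set.range fun i => (1 : L) ⊗ₜ[B] c i)
  have hN : ∀ z ∈ Submodule.span B (Set.range c), (1 : L) ⊗ₜ[B] z ∈ N := by
    intro z hz
    induction hz using Submodule.span_induction with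
    | mem x h => obtain ⟨i, rfl⟩ := h; exact Submodule.subset_span ⟨i, rfl⟩
    | zero => simp
    | add x y _ _ hx hy => rw [TensorProduct.tmul_add]; exact N.add_mem hx hy
    | smul a x _ hx =>
      have : (1 : L) ⊗ₜ[B] (a • x) = algebraMap B L a • ((1 : L) ⊗ₜ[B] x) := by
        simp
      rw [this]; exact N.smul_mem _ hx
  have hN' : ∀ z ∈ Z, (1 : L) ⊗ₜ[B] z ∈ N := fun z hz => by
    have h1 := hN _ (hQ z hz)
    have hu : IsUnit (algebraMap B L Q) := IsLocalization.Away.algebraMap_isUnit Q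
    have h2 : (1 : L) ⊗ₜ[B] z = (↑(hu.unit⁻¹) : L) • ((1 : L) ⊗ₜ[B] (Q • z)) := by
      have : (1 : L) ⊗ₜ[B] (Q • z) = algebraMap B L Q • ((1 : L) ⊗ₜ[B] z) := by simp
      rw [this, smul_smul]
      simp
    rw [h2]; exact N.smul_mem _ h1
  have hmul : ∀ x ∈ s, ∀ n ∈ N, ((1 : L) ⊗ₜ[B] x) * n ∈ N := by
    intro x hx n hn
    induction hn using Submodule.span_induction with
    | mem y h =>
      obtain ⟨i, rfl⟩ := h
      simp only [Algebra.TensorProduct.tmul_mul_tmul, one_mul]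
      refine hN' _ (Finset.mem_insert_of_mem ?_)
      exact Finset.mem_image₂_of_mem hx (by simp)
    | zero => simp
    | add x y _ _ hx hy => rw [mul_add]; exact N.add_mem hx hy
    | smul a x _ hx => rw [mul_smul_comm]; exact N.smul_mem _ hx
  have hall : ∀ x : C, ∀ n ∈ N, ((1 : L) ⊗ₜ[B] x) * n ∈ N := by
    intro x
    have hx : x ∈ Algebra.adjoin B (s : Set C) := by rw [hs']; trivial
    induction hx using Algebra.adjoin_induction with
    | mem x h => exact hmul x h
    | algebraMap r =>
      intro n hn
      have : (1 : L) ⊗ₜ[B] (algebraMap B C r) * n = algebraMap B L r • n := by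
        rw [Algebra.algebraMap_eq_smul_one, TensorProduct.tmul_smul, smul_mul_assoc,
          ← Algebra.TensorProduct.one_def, one_mul, algebraMap_smul]
      rw [this]; exact N.smul_mem _ hn
    | add x y _ _ hx hy =>
      intro n hn
      rw [TensorProduct.tmul_add, add_mul]; exact N.add_mem (hx n hn) (hy n hn)
    | mul x y _ _ hx hy =>
      intro n hn
      have : (1 : L) ⊗ₜ[B] (x * y) = ((1 : L) ⊗ₜ[B] x) * ((1 : L) ⊗ₜ[B] y) := by simp
      rw [this, mul_assoc]; exact hx _ (hy n hn)
  have htop : ⊤ ≤ N := by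
    rintro x -
    induction x with
    | zero => exact Submodule.zero_mem _
    | tmul a b =>
      have : a ⊗ₜ[B] b = a • (((1 : L) ⊗ₜ[B] b) * ((1 : L) ⊗ₜ[B] 1)) := by
        simp [TensorProduct.smul_tmul']
      rw [this]
      exact N.smul_mem _ (hall _ _ (hN' _ (Finset.mem_insert_self _ _)))
    | add x y hx hy => exact Submodule.add_mem _ hx hy
  have hunit : IsUnit (algebraMap B K Q) :=
    IsUnit.mk0 _ (by simpa using hQ0)
  let f : L →+* K := IsLocalization.Away.lift Q hunit
  have hf1 : ∀ x, f (algebraMap B L x) = algebraMap B K x := fun x => by simp [f]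
  have hfi : Function.Injective f := by
    rw [injective_iff_map_eq_zero]
    intro x hx
    obtain ⟨⟨y, t⟩, hy⟩ := IsLocalization.surj (Submonoid.powers Q) x
    have h3 := congrArg f hy
    simp only [map_mul, hx, zero_mul, hf1] at h3
    have h4 : y = 0 := by simpa using h3.symm
    rw [h4, map_zero] at hy
    exact ((IsLocalization.map_units L t).mul_left_eq_zero).1 hy
  let fa : L →ₐ[B] K := ⟨f, hf1⟩
  let θ := Algebra.TensorProduct.map fa (AlgHom.id B C)
  have hLI : LinearIndependent L (fun i => (1 : L) ⊗ₜ[B] c i) := by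
    rw [Fintype.linearIndependent_iff]
    intro g hg i
    have h5 := congrArg θ hg
    simp only [map_sum, TensorProduct.smul_tmul', smul_eq_mul, mul_one, map_zero] at h5
    have h6 := (Fintype.linearIndependent_iff.1 hli') (fun i => f (g i)) (by
      rw [← h5]
      refine Finset.sum_congr rfl fun j _ => ?_
      simp [θ, fa, TensorProduct.smul_tmul']) i
    exact hfi (by simpa using h6)
  exact ⟨(Module.Basis.mk hLI htop).reindex (Fintype.equivFin b)⟩
end

section
open scoped TensorProduct

lemma gen_parity {B C : Type} [CommRing B] [IsDomain B] [CommRing C] [Algebra B C]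
    [Algebra.FiniteType B C] [Algebra.FormallyUnramified B C] :
    ∃ Q : B, Q ≠ 0 ∧ ∃ D : ℕ, ∀ χ : B →+* ℝ, χ Q ≠ 0 →
      Finite {φ : C →+* ℝ // φ.comp (algebraMap B C) = χ} ∧
      Nat.card {φ : C →+* ℝ // φ.comp (algebraMap B C) = χ} ≡ D [MOD 2] := by
  have : Module.Finite (FractionRing B) (FractionRing B ⊗[B] C) :=
    Algebra.FormallyUnramified.finite_of_free _ _
  obtain ⟨Q, hQ, ⟨b⟩⟩ := gen_basis (B := B) (C := C)
  refine ⟨Q, hQ, Module.finrank (FractionRing B) (FractionRing B ⊗[B] C), fun χ hχ => ?_⟩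
  set L := Localization.Away Q
  let f : L →+* ℝ := IsLocalization.Away.lift Q (IsUnit.mk0 _ hχ)
  have hf1 : ∀ x, f (algebraMap B L x) = χ x := fun x => by simp [f]
  letI : Algebra B ℝ := χ.toAlgebra
  letI : Algebra L ℝ := f.toAlgebra
  have : IsScalarTower B L ℝ := IsScalarTower.of_algebraMap_eq fun x => (hf1 x).symm
  have hLfin : Module.Finite L (L ⊗[B] C) := Module.Finite.of_basis b
  have hLfree : Module.Free L (L ⊗[B] C) := Module.Free.of_basis b
  let R := ℝ ⊗[L] (L ⊗[B] C)
  obtain ⟨h1, h2⟩ := count_unram R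
  have hnt : Nontrivial L := RingHom.domain_nontrivial f
  rw [Module.finrank_baseChange, Module.finrank_eq_card_basis b, Fintype.card_fin] at h2
  let e1 : ((L ⊗[B] C) →ₐ[L] ℝ) ≃ (R →ₐ[ℝ] ℝ) := AlgHom.liftEquiv L ℝ (L ⊗[B] C) ℝ
  let e2 : (C →ₐ[B] ℝ) ≃ ((L ⊗[B] C) →ₐ[L] ℝ) := AlgHom.liftEquiv B L C ℝ
  let e3 : (C →ₐ[B] ℝ) ≃ {φ : C →+* ℝ // φ.comp (algebraMap B C) = χ} :=
    { toFun := fun φ => ⟨φ, φ.comp_algebraMap⟩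
      invFun := fun φ => ⟨φ.1, fun x => DFunLike.congr_fun φ.2 x⟩
      left_inv := fun φ => rfl
      right_inv := fun φ => rfl }
  let e := (e3.symm.trans e2).trans e1
  refine ⟨Finite.of_equiv _ e.symm, ?_⟩
  rw [Nat.card_congr e]
  exact h2

open MvPolynomial in
/-- The parity core. -/
lemma parity_core {B : Type} [CommRing B] [IsDomain B] {σ : Type} [Fintype σ] [DecidableEq σ]
    (I : Ideal (MvPolynomial σ B)) (p : σ → MvPolynomial σ B) (hp : ∀ i, p i ∈ I)
    (E : MvPolynomial σ B) (hE : (Matrix.of fun i j => pderiv j (p i)).det ∣ E) :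
    ∃ Q : B, Q ≠ 0 ∧ ∃ D : ℕ, ∀ χ : B →+* ℝ, χ Q ≠ 0 →
      {x : σ → ℝ | (∀ f ∈ I, eval₂ χ x f = 0) ∧ eval₂ χ x E ≠ 0}.Finite ∧
      {x : σ → ℝ | (∀ f ∈ I, eval₂ χ x f = 0) ∧ eval₂ χ x E ≠ 0}.ncard ≡ D [MOD 2] := by
  classical
  let P := MvPolynomial σ B
  let A := P ⧸ I
  let C := Localization.Away (Ideal.Quotient.mk I E)
  have hsurj : Function.Surjective (algebraMap P A) := Ideal.Quotient.mk_surjective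
  have : Algebra.FiniteType B A := inferInstance
  have : Algebra.FiniteType B C := inferInstance
  -- unramified
  have hunr : Algebra.FormallyUnramified B C := by
    let ψ : P →+* C := (algebraMap A C).comp (Ideal.Quotient.mk I)
    have hψ : ∀ x, algebraMap P C x = ψ x := fun x => IsScalarTower.algebraMap_apply P A C x
    have hdet : IsUnit (ψ (Matrix.of fun i j => pderiv j (p i)).det) :=
      isUnit_of_dvd_unit (map_dvd ψ hE) (IsLocalization.Away.algebraMap_isUnit (Ideal.Quotient.mk I E))
    let d := KaehlerDifferential.D B C
    let δ : Derivation B P (Ω[C⁄B]) := d.compAlgebraMap P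
    have hδ : ∀ f : P, δ f = d (algebraMap P C f) := fun f => rfl
    have hsum : ∀ f : P, δ f = ∑ j, ψ (pderiv j f) • δ (X j) := by
      intro f
      induction f using MvPolynomial.induction_on with
      | C a =>
        have : δ (MvPolynomial.C a) = 0 := δ.map_algebraMap a
        simp [this]
      | add p q hp hq => simp only [map_add, hp, hq, add_smul, Finset.sum_add_distrib]
      | mul_X q i hq =>
        have key : ∀ (a : P) (m : Ω[C⁄B]), a • m = ψ a • m := fun a m => by
          rw [← hψ, algebraMap_smul]
        rw [Derivation.leibniz, hq]
        simp only [Derivation.leibniz, pderiv_X, smul_eq_mul, map_add, map_mul, add_smul,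
          Finset.sum_add_distrib, key, Finset.smul_sum, mul_smul]
        congr 1
        rw [Finset.sum_eq_single i]
        · simp
        · intro j _ hj
          simp [Pi.single_apply, hj.symm]
        · intro h; exact absurd (Finset.mem_univ i) h
    have h0 : ∀ i, δ (p i) = 0 := fun i => by
      rw [hδ, hψ]
      have : ψ (p i) = 0 := by
        change algebraMap A C (Ideal.Quotient.mk I (p i)) = 0
        rw [Ideal.Quotient.eq_zero_iff_mem.2 (hp i), map_zero]
      rw [this, map_zero]
    have hX : ∀ k, δ (X k) = 0 := by
      intro k
      let M : Matrix σ σ C := (Matrix.of fun i j => pderiv j (p i)).map ψ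
      have hM : ∀ i, ∑ j, M i j • δ (X j) = 0 := fun i => by
        rw [← h0 i, hsum (p i)]; rfl
      have h3 : M.det • δ (X k) = 0 := by
        calc M.det • δ (X k) = ∑ j, (M.adjugate * M) k j • δ (X j) := by
              rw [Matrix.adjugate_mul]
              simp [Matrix.smul_apply, Matrix.one_apply, ite_smul]
          _ = ∑ i, M.adjugate k i • ∑ j, M i j • δ (X j) := by
              simp only [Matrix.mul_apply, Finset.smul_sum, smul_smul]
              rw [Finset.sum_comm]
              exact Finset.sum_congr rfl fun j _ => Finset.sum_smul
          _ = 0 := by simp [hM]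
      have hd : M.det = ψ (Matrix.of fun i j => pderiv j (p i)).det := by
        rw [RingHom.map_det]; rfl
      rw [hd] at h3
      exact (hdet.smul_eq_zero).1 h3
    have hz : ∀ f : P, d (ψ f) = 0 := fun f => by
      rw [← hψ, ← hδ, hsum f]; simp [hX]
    have hz' : ∀ c : C, d c = 0 := by
      intro c
      obtain ⟨⟨a, t⟩, hat⟩ := IsLocalization.surj (Submonoid.powers (Ideal.Quotient.mk I E)) c
      obtain ⟨a', rfl⟩ := Ideal.Quotient.mk_surjective a
      obtain ⟨t', ht'⟩ := Ideal.Quotient.mk_surjective t.1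
      have h4 := congrArg d hat
      have h5 : d (algebraMap A C t.1) = 0 := by rw [← ht']; exact hz t'
      have h6 : d (algebraMap A C (Ideal.Quotient.mk I a')) = 0 := hz a'
      rw [Derivation.leibniz, h5, h6, smul_zero, zero_add] at h4
      exact ((IsLocalization.map_units C t).smul_eq_zero).1 h4
    refine ⟨?_⟩
    have hspan := KaehlerDifferential.span_range_derivation B C
    have : Set.range (KaehlerDifferential.D B C) ⊆ {0} := by
      rintro _ ⟨c, rfl⟩; exact hz' c
    have hbot : (⊤ : Submodule C (Ω[C⁄B])) = ⊥ := by
      rw [← hspan, Submodule.span_eq_bot]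
      intro x hx; exact this hx
    refine ⟨fun a b => ?_⟩
    have ha : a ∈ (⊤ : Submodule C (Ω[C⁄B])) := trivial
    have hb : b ∈ (⊤ : Submodule C (Ω[C⁄B])) := trivial
    rw [hbot, Submodule.mem_bot] at ha hb
    rw [ha, hb]
  obtain ⟨Q, hQ, D, h⟩ := gen_parity (B := B) (C := C)
  refine ⟨Q, hQ, D, fun χ hχ => ?_⟩
  obtain ⟨h1, h2⟩ := h χ hχ
  let Zs := {x : σ → ℝ | (∀ f ∈ I, eval₂ χ x f = 0) ∧ eval₂ χ x E ≠ 0}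
  have hφe : ∀ φ : C →+* ℝ, φ.comp (algebraMap B C) = χ → ∀ f : P,
      eval₂ χ (fun i => φ (algebraMap A C (Ideal.Quotient.mk I (X i)))) f
        = φ (algebraMap A C (Ideal.Quotient.mk I f)) := by
    intro φ hφ f
    have : (eval₂Hom χ (fun i => φ (algebraMap A C (Ideal.Quotient.mk I (X i))))) =
        (φ.comp (algebraMap A C)).comp (Ideal.Quotient.mk I) := by
      apply MvPolynomial.ringHom_ext
      · intro r
        rw [← hφ]
        simp only [coe_eval₂Hom, eval₂_C, RingHom.comp_apply]
        rw [IsScalarTower.algebraMap_apply B A C]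
        rfl
      · intro i; simp
    exact DFunLike.congr_fun this f
  let e : {φ : C →+* ℝ // φ.comp (algebraMap B C) = χ} ≃ Zs :=
    { toFun := fun φ => ⟨fun i => φ.1 (algebraMap A C (Ideal.Quotient.mk I (X i))), by
        refine ⟨fun f hf => ?_, ?_⟩
        · rw [hφe φ.1 φ.2, Ideal.Quotient.eq_zero_iff_mem.2 hf, map_zero, map_zero]
        · rw [hφe φ.1 φ.2]
          exact ((IsLocalization.Away.algebraMap_isUnit (Ideal.Quotient.mk I E)).map φ.1).ne_zero⟩
      invFun := fun x => ⟨IsLocalization.Away.lift (Ideal.Quotient.mk I E)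
        (g := Ideal.Quotient.lift I (eval₂Hom χ x.1) x.2.1) (IsUnit.mk0 _ x.2.2), by
        ext b
        rw [RingHom.comp_apply, IsScalarTower.algebraMap_apply B A C, IsLocalization.Away.lift_eq]
        exact eval₂_C χ x.1 b⟩
      left_inv := fun φ => by
        apply Subtype.ext
        apply IsLocalization.ringHom_ext (Submonoid.powers (Ideal.Quotient.mk I E))
        apply Ideal.Quotient.ringHom_ext
        ext f
        · simp only [RingHom.comp_apply, IsLocalization.Away.lift_eq, Ideal.Quotient.lift_mk]
          exact hφe φ.1 φ.2 _
        · simp only [RingHom.comp_apply, IsLocalization.Away.lift_eq, Ideal.Quotient.lift_mk]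
          exact hφe φ.1 φ.2 _
      right_inv := fun x => by
        apply Subtype.ext
        funext i
        have h7 := IsLocalization.Away.lift_eq (S := C) (Ideal.Quotient.mk I E)
          (g := Ideal.Quotient.lift I (eval₂Hom χ x.1) x.2.1) (IsUnit.mk0 _ x.2.2)
          (Ideal.Quotient.mk I (X i))
        have h8 := eval₂_X χ x.1 i
        exact h7.trans h8 }
  have : Finite Zs := Finite.of_equiv _ e
  exact ⟨Set.toFinite Zs, by rw [← Nat.card_coe_set_eq, ← Nat.card_congr e]; exact h2⟩
end

section
open Topology Filter

lemma ift_count {σ : Type} [Fintype σ] (Ξ : ℝ × (σ → ℝ) → (σ → ℝ)) (hΞ : ContDiff ℝ 1 Ξ) (s0 : ℝ)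
    (R : Finset (σ → ℝ)) (h0 : ∀ x ∈ R, Ξ (s0, x) = 0)
    (hinv : ∀ x ∈ R, ((fderiv ℝ Ξ (s0, x)).comp (ContinuousLinearMap.inr ℝ ℝ (σ → ℝ))).IsInvertible)
    (Z : ℝ → Set (σ → ℝ)) (hZ : ∀ s, ∀ x ∈ Z s, Ξ (s, x) = 0)
    (hi : ∀ x ∈ R, ∀ᶠ v in 𝓝 (s0, x), Ξ v = 0 → v.2 ∈ Z v.1)
    (hii : ∀ O : Set (σ → ℝ), IsOpen O → ↑R ⊆ O → ∀ᶠ s in 𝓝 s0, Z s ⊆ O) :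
    ∀ᶠ s in 𝓝 s0, (Z s).ncard = R.card := by
  classical
  have h1 : ∀ x ∈ R, ∃ ψ : ℝ → (σ → ℝ), Tendsto ψ (𝓝 s0) (𝓝 x) ∧
      ∀ᶠ v in 𝓝 (s0, x), Ξ v = 0 ↔ ψ v.1 = v.2 := by
    intro x hx
    have hd : HasStrictFDerivAt Ξ (fderiv ℝ Ξ (s0, x)) (s0, x) :=
      hΞ.contDiffAt.hasStrictFDerivAt one_ne_zero
    refine ⟨hd.implicitFunctionOfProdDomain (hinv x hx),
      hd.tendsto_implicitFunctionOfProdDomain (hinv x hx), ?_⟩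
    have := hd.eventually_apply_eq_iff_implicitFunctionOfProdDomain (hinv x hx)
    rwa [h0 x hx] at this
  choose! ψ hψ1 hψ2 using h1
  obtain ⟨V, hV, hVd⟩ := (R.finite_toSet).t2_separation
  have h2 : ∀ x ∈ R, ∃ U : Set (σ → ℝ), IsOpen U ∧ x ∈ U ∧ U ⊆ V x ∧
      ∀ᶠ s in 𝓝 s0, ∀ y ∈ U, (Ξ (s, y) = 0 ↔ ψ x s = y) ∧ (Ξ (s, y) = 0 → y ∈ Z s) := by
    intro x hx
    have h3 := (hψ2 x hx).and (hi x hx)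
    rw [nhds_prod_eq, eventually_prod_iff] at h3
    obtain ⟨pa, ha, pb, hb, h⟩ := h3
    obtain ⟨U, hU, hUo, hxU⟩ := mem_nhds_iff.1 (inter_mem hb ((hV x).2.mem_nhds (hV x).1))
    refine ⟨U, hUo, hxU, fun y hy => (hU hy).2, ?_⟩
    filter_upwards [ha] with s hs y hy
    exact h hs (hU hy).1
  choose! U hUo hxU hUV hU using h2
  have e1 : ∀ᶠ s in 𝓝 s0, ∀ x ∈ R, ∀ y ∈ U x,
      (Ξ (s, y) = 0 ↔ ψ x s = y) ∧ (Ξ (s, y) = 0 → y ∈ Z s) :=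
    (eventually_all_finset R).2 fun x hx => hU x hx
  have e2 : ∀ᶠ s in 𝓝 s0, ∀ x ∈ R, ψ x s ∈ U x :=
    (eventually_all_finset R).2 fun x hx => (hψ1 x hx) ((hUo x hx).mem_nhds (hxU x hx))
  have e3 := hii (⋃ x ∈ R, U x) (isOpen_biUnion fun x hx => hUo x hx)
    (fun x hx => Set.mem_biUnion hx (hxU x hx))
  filter_upwards [e1, e2, e3] with s h1 h2 h3
  have hZs : Z s = ↑(R.image fun x => ψ x s) := by
    ext y
    simp only [Finset.coe_image, Set.mem_image, Finset.mem_coe]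
    constructor
    · intro hy
      obtain ⟨x, hx, hyx⟩ := Set.mem_iUnion₂.1 (h3 hy)
      exact ⟨x, hx, (h1 x hx y hyx).1.1 (hZ s y hy)⟩
    · rintro ⟨x, hx, rfl⟩
      have := h1 x hx _ (h2 x hx)
      exact this.2 (this.1.2 rfl)
  rw [hZs, Set.ncard_coe_finset, Finset.card_image_of_injOn]
  intro x hx y hy hxy
  by_contra hne
  have hd := hVd hx hy hne
  exact Set.disjoint_left.1 hd (hUV x hx (h2 x hx)) (by
    have : ψ x s = ψ y s := hxy
    rw [this]; exact hUV y hy (h2 y hy))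

open MvPolynomial

/-- evaluation of a family -/
noncomputable abbrev fev {σ : Type} (s : ℝ) (x : σ → ℝ) : MvPolynomial σ (Polynomial ℝ) →+* ℝ :=
  eval₂Hom (Polynomial.evalRingHom s) x

lemma fev_contDiff {σ : Type} [Fintype σ] (f : MvPolynomial σ (Polynomial ℝ)) :
    ContDiff ℝ 1 (fun v : ℝ × (σ → ℝ) => fev v.1 v.2 f) := by
  induction f using MvPolynomial.induction_on with
  | C a =>
    simp only [coe_eval₂Hom, eval₂_C, Polynomial.coe_evalRingHom]
    have := (Polynomial.contDiff_aeval (𝕜 := ℝ) a 1).comp (contDiff_fst (E := ℝ) (F := σ → ℝ))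
    simp only [Polynomial.coe_aeval_eq_eval] at this
    exact this
  | add p q hp hq => simp only [map_add]; exact hp.add hq
  | mul_X p i hp =>
    simp only [map_mul]
    refine hp.mul ?_
    simp only [coe_eval₂Hom, eval₂_X]
    exact (contDiff_apply ℝ ℝ i).comp contDiff_snd

lemma fev_hasFDeriv {σ : Type} [Fintype σ] (f : MvPolynomial σ (Polynomial ℝ)) (s : ℝ) (x : σ → ℝ) :
    HasFDerivAt (fun x : σ → ℝ => fev s x f)
      (∑ j, fev s x (pderiv j f) • (ContinuousLinearMap.proj j : (σ → ℝ) →L[ℝ] ℝ)) x := by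
  classical
  induction f using MvPolynomial.induction_on with
  | C a =>
    simp only [coe_eval₂Hom, eval₂_C, pderiv_C, eval₂_zero, zero_smul, Finset.sum_const_zero]
    exact hasFDerivAt_const _ _
  | add p q hp hq =>
    simp only [map_add, add_smul, Finset.sum_add_distrib]; exact hp.add hq
  | mul_X p i hp =>
    have h1 : HasFDerivAt (fun x : σ → ℝ => fev s x (X i))
        (ContinuousLinearMap.proj i : (σ → ℝ) →L[ℝ] ℝ) x := by
      simp only [coe_eval₂Hom, eval₂_X]
      exact (ContinuousLinearMap.proj i : (σ → ℝ) →L[ℝ] ℝ).hasFDerivAt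
    simp only [map_mul]
    refine (hp.mul h1).congr_fderiv ?_
    simp only [Derivation.leibniz, pderiv_X, smul_eq_mul, map_add, map_mul, add_smul,
      Finset.sum_add_distrib, Finset.smul_sum, mul_smul]
    symm
    congr 1
    rw [Finset.sum_eq_single i]
    · simp
    · intro j _ hj
      simp [Pi.single_apply, hj.symm]
    · intro h; exact absurd (Finset.mem_univ i) h

/-- solution set of a family -/
def famZ {σ : Type} (I : Ideal (MvPolynomial σ (Polynomial ℝ))) (E : MvPolynomial σ (Polynomial ℝ))
    (s : ℝ) : Set (σ → ℝ) := {x | (∀ f ∈ I, fev s x f = 0) ∧ fev s x E ≠ 0}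

lemma fam_parity {σ : Type} [Fintype σ] [DecidableEq σ]
    (I : Ideal (MvPolynomial σ (Polynomial ℝ))) (p : σ → MvPolynomial σ (Polynomial ℝ))
    (hp : ∀ i, p i ∈ I)
    (E : MvPolynomial σ (Polynomial ℝ)) (hE : (Matrix.of fun i j => pderiv j (p i)).det ∣ E) :
    ∃ D : ℕ, ∀ s0 : ℝ, ∀ᶠ s in 𝓝[≠] s0, (famZ I E s).ncard ≡ D [MOD 2] := by
  obtain ⟨Q, hQ, D, h⟩ := parity_core I p hp E hE
  refine ⟨D, fun s0 => ?_⟩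
  have hfin : {s | Polynomial.eval s Q = 0}.Finite := by
    refine (Q.roots.toFinset.finite_toSet).subset fun s hs => ?_
    have hs' : Polynomial.eval s Q = 0 := hs
    simp [hQ, hs']
  have h1 : ∀ᶠ s in 𝓝[≠] s0, Polynomial.eval s Q ≠ 0 := by
    have h2 : ({s | Polynomial.eval s Q = 0} \ {s0})ᶜ ∈ 𝓝 s0 :=
      (hfin.subset Set.diff_subset).isClosed.isOpen_compl.mem_nhds (by simp)
    filter_upwards [mem_nhdsWithin_of_mem_nhds h2, self_mem_nhdsWithin] with s hs hs0 h3
    exact hs ⟨h3, hs0⟩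
  filter_upwards [h1] with s hs
  exact (h (Polynomial.evalRingHom s) hs).2

lemma fam_count {σ : Type} [Fintype σ] [DecidableEq σ]
    (I : Ideal (MvPolynomial σ (Polynomial ℝ))) (p : σ → MvPolynomial σ (Polynomial ℝ))
    (hp : ∀ i, p i ∈ I) (E : MvPolynomial σ (Polynomial ℝ)) (s0 : ℝ)
    (R : Finset (σ → ℝ)) (h0 : ∀ x ∈ R, ∀ i, fev s0 x (p i) = 0)
    (hdet : ∀ x ∈ R, (Matrix.of fun i j => fev s0 x (pderiv j (p i))).det ≠ 0)
    (hi : ∀ x ∈ R, ∀ᶠ v in 𝓝 (s0, x), (∀ i, fev v.1 v.2 (p i) = 0) → v.2 ∈ famZ I E v.1)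
    (hii : ∀ O : Set (σ → ℝ), IsOpen O → ↑R ⊆ O → ∀ᶠ s in 𝓝 s0, famZ I E s ⊆ O) :
    ∀ᶠ s in 𝓝 s0, (famZ I E s).ncard = R.card := by
  let Ξ : ℝ × (σ → ℝ) → (σ → ℝ) := fun v i => fev v.1 v.2 (p i)
  have hΞ : ContDiff ℝ 1 Ξ := contDiff_pi.2 fun i => fev_contDiff (p i)
  refine ift_count Ξ hΞ s0 R (fun x hx => funext fun i => h0 x hx i) ?_ (famZ I E)
    (fun s x hx => funext fun i => hx.1 _ (hp i)) ?_ hii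
  · intro x hx
    let M := (Matrix.of fun i j => fev s0 x (pderiv j (p i)))
    have hM : (fderiv ℝ Ξ (s0, x)).comp (ContinuousLinearMap.inr ℝ ℝ (σ → ℝ)) =
        LinearMap.toContinuousLinearMap (Matrix.toLin' M) := by
      have a1 : HasFDerivAt (fun y => Ξ (s0, y))
          ((fderiv ℝ Ξ (s0, x)).comp (ContinuousLinearMap.inr ℝ ℝ (σ → ℝ))) x := by
        have b1 := (hΞ.differentiable one_ne_zero (s0, x)).hasFDerivAt
        have b2 : HasFDerivAt (fun y : σ → ℝ => (s0, y)) (ContinuousLinearMap.inr ℝ ℝ (σ → ℝ)) x :=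
          hasFDerivAt_prodMk_right s0 x
        exact b1.comp x b2
      have a2 : HasFDerivAt (fun y => Ξ (s0, y)) (LinearMap.toContinuousLinearMap (Matrix.toLin' M)) x := by
        rw [hasFDerivAt_pi']
        intro i
        refine (fev_hasFDeriv (p i) s0 x).congr_fderiv ?_
        ext v
        simp [M, Matrix.mulVec, dotProduct]
      exact a1.unique a2
    rw [hM]
    have hu : IsUnit M.det := isUnit_iff_ne_zero.2 (hdet x hx)
    exact ⟨(Matrix.toLin'OfInv (Matrix.mul_nonsing_inv M hu) (Matrix.nonsing_inv_mul M hu)).symm.toContinuousLinearEquiv, by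
      ext; rfl⟩
  · intro x hx
    filter_upwards [hi x hx] with v hv h
    exact hv fun i => congrFun h i
end

section
open Topology Filter MvPolynomial

lemma stone_w {σ : Type} (K : Set (σ → ℝ)) (hK : IsCompact K) (f : (σ → ℝ) → ℝ)
    (hf : ContinuousOn f K) (ε : ℝ) (hε : 0 < ε) :
    ∃ p : MvPolynomial σ ℝ, ∀ x ∈ K, |eval x p - f x| < ε := by
  haveI : CompactSpace K := isCompact_iff_compactSpace.1 hK
  let c : σ → C(K, ℝ) := fun i => ⟨fun x => x.1 i, (continuous_apply i).comp continuous_subtype_val⟩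
  let φ : MvPolynomial σ ℝ →ₐ[ℝ] C(K, ℝ) := aeval c
  have hφ : ∀ p (x : K), φ p x = eval x.1 p := by
    intro p x
    induction p using MvPolynomial.induction_on with
    | C a => simp [φ]
    | add p q hp hq => simp [map_add, hp, hq]
    | mul_X p i hp => rw [map_mul, ContinuousMap.mul_apply, hp]; simp [φ, c]
  have hsep : (φ.range).SeparatesPoints := by
    intro x y hxy
    have : ∃ i, x.1 i ≠ y.1 i := by
      by_contra h
      push Not at h
      exact hxy (Subtype.ext (funext h))
    obtain ⟨i, hi⟩ := this
    refine ⟨c i, ⟨c i, ⟨X i, by simp [φ]⟩, rfl⟩, hi⟩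
  obtain ⟨⟨g, p, rfl⟩, hp⟩ := ContinuousMap.exists_mem_subalgebra_near_continuous_of_separatesPoints
    φ.range hsep (fun x : K => f x.1) (hf.domRestrict) ε hε
  refine ⟨p, fun x hx => ?_⟩
  have := hp ⟨x, hx⟩
  have h2 := hφ p ⟨x, hx⟩
  rw [Real.norm_eq_abs] at this
  rw [← h2]
  exact this

lemma fev_map {σ : Type} (s : ℝ) (x : σ → ℝ) (f : MvPolynomial σ ℝ) :
    fev s x (map Polynomial.C f) = eval x f := by
  simp only [fev, coe_eval₂Hom, eval₂_map]
  have : (Polynomial.evalRingHom s).comp Polynomial.C = RingHom.id ℝ := by ext; simp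
  rw [this]; rfl

lemma fev_s {σ : Type} (s : ℝ) (x : σ → ℝ) : fev s x (C Polynomial.X) = s := by simp [fev]

lemma fev_C {σ : Type} (s : ℝ) (x : σ → ℝ) (a : Polynomial ℝ) : fev s x (C a) = a.eval s := by simp [fev]

lemma fev_X {σ : Type} (s : ℝ) (x : σ → ℝ) (i : σ) : fev s x (X i) = x i := by simp [fev]

lemma fev_cont {σ : Type} [Fintype σ] (f : MvPolynomial σ (Polynomial ℝ)) :
    Continuous (fun v : ℝ × (σ → ℝ) => fev v.1 v.2 f) := (fev_contDiff f).continuous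

lemma famZ_span {σ ι : Type} (p : ι → MvPolynomial σ (Polynomial ℝ)) (E) (s : ℝ) (x : σ → ℝ) :
    x ∈ famZ (Ideal.span (Set.range p)) E s ↔ (∀ i, fev s x (p i) = 0) ∧ fev s x E ≠ 0 := by
  constructor
  · rintro ⟨h, h'⟩
    exact ⟨fun i => h _ (Ideal.subset_span ⟨i, rfl⟩), h'⟩
  · rintro ⟨h, h'⟩
    refine ⟨fun f hf => ?_, h'⟩
    have : Ideal.span (Set.range p) ≤ RingHom.ker (fev s x) := by
      rw [Ideal.span_le]
      rintro _ ⟨i, rfl⟩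
      exact h i
    exact this hf

/-- the cone coordinate -/
noncomputable def Wp (n : ℕ) : Fin (n+1) → MvPolynomial (Fin (n+1)) ℝ :=
  Fin.cons 1 fun i => X i.succ
def Wv {n : ℕ} (v : Fin (n+1) → ℝ) : Fin (n+1) → ℝ := Fin.cons 1 fun i => v i.succ

lemma Wp_eval {n : ℕ} (v : Fin (n+1) → ℝ) (i) : eval v (Wp n i) = Wv v i := by
  refine Fin.cases ?_ (fun j => ?_) i <;> simp [Wp, Wv]

lemma even_odd {n : ℕ} (p : MvPolynomial (Fin (n+1)) ℝ) :
    ∃ pe po : MvPolynomial (Fin (n+1)) ℝ, ∀ v r, v 0 = r ^ 2 →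
      eval (r • Wv v) p = eval v pe + r * eval v po := by
  induction p using MvPolynomial.induction_on with
  | C a => exact ⟨C a, 0, fun v r h => by simp⟩
  | add p q hp hq =>
    obtain ⟨a, b, h⟩ := hp
    obtain ⟨c, d, h'⟩ := hq
    refine ⟨a + c, b + d, fun v r hv => ?_⟩
    simp only [map_add, h v r hv, h' v r hv]; ring
  | mul_X p i hp =>
    obtain ⟨a, b, h⟩ := hp
    refine ⟨X 0 * Wp n i * b, Wp n i * a, fun v r hv => ?_⟩
    simp only [map_mul, h v r hv, Wp_eval, eval_X, hv, Pi.smul_apply, smul_eq_mul]; ring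

theorem borsuk_ulam {n : ℕ} (g : (Fin (n+1) → ℝ) → (Fin n → ℝ))
    (hg : ContinuousOn g {x | x ≠ 0}) (hodd : ∀ x, x ≠ 0 → g (-x) = - g x)
    (hne : ∀ x, x ≠ 0 → g x ≠ 0) : False := by
  classical
  let S : Set (Fin (n+1) → ℝ) := {x | ∑ i, x i ^ 2 = 1}
  have hSb : ∀ x ∈ S, ∀ i, |x i| ≤ 1 := by
    intro x hx i
    have h1 : x i ^ 2 ≤ ∑ i, x i ^ 2 := Finset.single_le_sum (f := fun i => x i ^ 2) (fun i _ => sq_nonneg (x i)) (Finset.mem_univ i)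
    have hx' : ∑ i, x i ^ 2 = 1 := hx
    rw [hx'] at h1
    exact (sq_le_one_iff_abs_le_one _).1 h1
  have hSc : IsCompact S := by
    refine Metric.isCompact_of_isClosed_isBounded (isClosed_eq (by fun_prop) (by fun_prop)) ?_
    refine (Metric.isBounded_iff_subset_closedBall 0).2 ⟨1, fun x hx => ?_⟩
    rw [mem_closedBall_zero_iff, pi_norm_le_iff_of_nonneg zero_le_one]
    exact hSb x hx
  have hS0 : ∀ x ∈ S, x ≠ 0 := by
    rintro x hx rfl
    simp [S] at hx
  have hSneg : ∀ x ∈ S, -x ∈ S := fun x hx => by simpa [S] using hx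
  have hgS : ContinuousOn g S := hg.mono hS0
  obtain ⟨ε, hε, hgε⟩ : ∃ ε > 0, ∀ x ∈ S, 2 * ε ≤ ‖g x‖ := by
    have hSne : S.Nonempty := ⟨Pi.single 0 1, by
      change ∑ i, (Pi.single 0 1 : Fin (n+1) → ℝ) i ^ 2 = 1
      rw [Fin.sum_univ_succ]; simp⟩
    obtain ⟨x0, hx0, hmin⟩ := hSc.exists_isMinOn hSne hgS.norm
    refine ⟨‖g x0‖ / 2, half_pos (norm_pos_iff.2 (hne _ (hS0 _ hx0))), fun x hx => ?_⟩
    have := hmin hx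
    simp only [Set.mem_setOf_eq] at this
    linarith
  have h1 : ∀ i, ∃ p : MvPolynomial (Fin (n+1)) ℝ, ∀ x ∈ S, |eval x p - g x i| < ε := fun i =>
    stone_w S hSc (fun x => g x i) (by
      exact (continuous_apply i).comp_continuousOn hgS) ε hε
  choose p hp using h1
  have h2 := fun i => even_odd (p i)
  choose pe po hpo using h2
  let G : (Fin (n+1) → ℝ) → Fin n → ℝ := fun x i => (eval x (p i) - eval (-x) (p i)) / 2
  have hG : ∀ x ∈ S, ∀ i, |G x i - g x i| < ε := by
    intro x hx i
    have a1 := hp i x hx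
    have a2 := hp i (-x) (hSneg x hx)
    rw [hodd x (hS0 x hx), Pi.neg_apply] at a2
    rw [abs_lt] at *
    constructor <;> simp only [G] <;> linarith
  obtain ⟨Cb, hCb⟩ : ∃ Cb, ∀ x ∈ S, ∀ i, |G x i| ≤ Cb := by
    have : ContinuousOn G S := by
      refine Continuous.continuousOn (continuous_pi fun i => ?_)
      exact ((continuous_eval (p i)).sub ((continuous_eval (p i)).comp continuous_neg)).div_const 2
    obtain ⟨c, hc⟩ := hSc.exists_bound_of_continuousOn this
    exact ⟨c, fun x hx i => (norm_le_pi_norm (G x) i).trans (hc x hx)⟩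
  let P : Fin (n+1) → MvPolynomial (Fin (n+1)) (Polynomial ℝ) :=
    Fin.cons (X 0 * (1 + ∑ i : Fin n, X i.succ ^ 2) - 1)
      fun i => C Polynomial.X * map Polynomial.C (po i) + C (1 - Polynomial.X) * X i.succ
  let I := Ideal.span (Set.range P)
  let E := (Matrix.of fun i j => pderiv j (P i)).det
  have key : ∀ s v, v ∈ famZ I E s → ∃ r : ℝ, 0 < r ∧ r • Wv v ∈ S ∧ v 0 = r ^ 2 ∧
      ∀ i : Fin n, s * G (r • Wv v) i + (1 - s) * (r * v i.succ) = 0 := by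
    intro s v hv
    rw [famZ_span] at hv
    have e0 := hv.1 0
    simp only [P, Fin.cons_zero, map_sub, map_mul, map_add, map_sum, map_pow, fev_X, map_one] at e0
    have hpos : 0 < v 0 := by
      have : 0 < 1 + ∑ i : Fin n, v i.succ ^ 2 := by positivity
      by_contra hcon
      nlinarith
    have hr : v 0 = √(v 0) ^ 2 := (Real.sq_sqrt hpos.le).symm
    refine ⟨√(v 0), Real.sqrt_pos.2 hpos, ?_, hr, fun i => ?_⟩
    · change ∑ i, (√(v 0) • Wv v) i ^ 2 = 1
      simp only [Pi.smul_apply, smul_eq_mul, mul_pow, ← Finset.mul_sum, ← hr]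
      rw [Fin.sum_univ_succ]
      simp only [Wv, Fin.cons_zero, Fin.cons_succ]
      linarith
    · have e1 := hv.1 i.succ
      simp only [P, Fin.cons_succ, map_mul, map_add, fev_s, fev_map, fev_C, fev_X,
        Polynomial.eval_sub, Polynomial.eval_one, Polynomial.eval_X] at e1
      have a1 := hpo i v (√(v 0)) hr
      have a2 := hpo i v (-√(v 0)) (by rw [neg_sq]; exact hr)
      simp only [G]
      rw [← neg_smul, a1, a2]
      linear_combination √(v 0) * e1
  obtain ⟨D, hD⟩ := fam_parity I P (fun i => Ideal.subset_span ⟨i, rfl⟩) E dvd_rfl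
  have c1 : ∀ᶠ s in 𝓝 (1:ℝ), (famZ I E s).ncard = 0 := by
    have : ∀ᶠ s in 𝓝 (1:ℝ), |s - 1| < min (1/2) (ε/2) := by
      have := Metric.ball_mem_nhds (1:ℝ) (show 0 < min (1/2) (ε/2) by positivity)
      filter_upwards [this] with s hs
      rwa [Metric.mem_ball, Real.dist_eq] at hs
    filter_upwards [this] with s hs
    have : famZ I E s = ∅ := by
      refine Set.eq_empty_iff_forall_notMem.2 fun v hv => ?_
      obtain ⟨r, hr, hx, h0, h⟩ := key s v hv
      set x := r • Wv v with hxd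
      obtain ⟨i, hi⟩ : ∃ i, 2 * ε ≤ |g x i| := by
        by_contra hcon
        push Not at hcon
        have := (pi_norm_lt_iff (x := g x) (r := 2 * ε) (by positivity)).2 hcon
        exact absurd (hgε x hx) (not_le.2 this)
      have b1 := hG x hx i
      have b2 := hSb x hx i.succ
      have b3 : x i.succ = r * v i.succ := by simp [hxd, Wv]
      rw [b3] at b2
      have b4 := h i
      have b5 : ε < |G x i| := by
        have := abs_sub_abs_le_abs_sub (g x i) (G x i)
        rw [abs_sub_comm] at this
        linarith
      have b6 : |s * G x i| = |(1 - s) * (r * v i.succ)| := by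
        rw [← abs_neg, show -(s * G x i) = (1 - s) * (r * v i.succ) by linarith]
      rw [abs_mul, abs_mul] at b6
      have b7 := lt_min_iff.1 hs
      have b8 : 1/2 < |s| := by
        have := (abs_lt.1 b7.1).1
        rw [abs_of_pos] <;> linarith
      have b9 : |1 - s| < ε / 2 := by rw [abs_sub_comm]; exact b7.2
      nlinarith [abs_nonneg (1 - s), abs_nonneg (r * v i.succ), abs_nonneg s]
    rw [this, Set.ncard_empty]
  have c0 : ∀ᶠ s in 𝓝 (0:ℝ), (famZ I E s).ncard = 1 := by
    let v0 : Fin (n+1) → ℝ := Fin.cons 1 fun _ => 0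
    have hM : (Matrix.of fun i j => fev 0 v0 (pderiv j (P i))) = 1 := by
      ext i j
      rw [Matrix.of_apply]
      refine Fin.cases ?_ (fun i => ?_) i
      · refine Fin.cases ?_ (fun j => ?_) j
        · simp [P, v0, fev, pderiv_X]
        · simp [P, v0, fev, pderiv_X, Fin.succ_ne_zero, (Fin.succ_ne_zero _).symm]
      · simp only [P, Fin.cons_succ, map_add, Derivation.leibniz, smul_eq_mul, pderiv_C, pderiv_X,
          map_mul, fev_s, fev_C]
        simp [Pi.single_apply, Matrix.one_apply]
    have := fam_count I P (fun i => Ideal.subset_span ⟨i, rfl⟩) E 0 {v0} ?_ ?_ ?_ ?_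
    · simpa using this
    · intro x hx i
      rw [Finset.mem_singleton] at hx
      subst hx
      refine Fin.cases ?_ (fun i => ?_) i
      · simp [P, v0]
      · simp [P, v0]
    · intro x hx
      rw [Finset.mem_singleton] at hx
      subst hx
      rw [hM]; simp
    · intro x hx
      rw [Finset.mem_singleton] at hx
      subst hx
      have hE : fev 0 v0 E ≠ 0 := by
        simp only [E]
        rw [RingHom.map_det]
        have : (fev 0 v0).mapMatrix (Matrix.of fun i j => pderiv j (P i)) = 1 := hM
        rw [this]; simp
      have := (fev_cont E).continuousAt (x := (0, v0)) |>.eventually_ne hE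
      filter_upwards [this] with v hv h
      exact (famZ_span _ _ _ _).2 ⟨h, hv⟩
    · intro O hO hRO
      let Φ : (Fin n → ℝ) → Fin (n+1) → ℝ := fun t =>
        Fin.cons (1 - ∑ i, t i ^ 2) fun i => t i / √(1 - ∑ i, t i ^ 2)
      have hΦ0 : Φ 0 = v0 := by
        ext i
        refine Fin.cases ?_ (fun i => ?_) i <;> simp [Φ, v0]
      have hΦ : ContinuousAt Φ 0 := by
        rw [continuousAt_pi]
        refine Fin.cases ?_ (fun i => ?_)
        · simp only [Φ, Fin.cons_zero]; exact Continuous.continuousAt (by fun_prop)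
        · simp only [Φ, Fin.cons_succ]
          refine ContinuousAt.div (continuous_apply i).continuousAt ?_ (by simp)
          exact Continuous.continuousAt (by fun_prop)
      have hO0 : ∀ᶠ t in 𝓝 (0 : Fin n → ℝ), Φ t ∈ O :=
        hΦ.eventually (by rw [hΦ0]; exact hO.mem_nhds (hRO (by simp)))
      obtain ⟨δ, hδ, hδO⟩ := Metric.eventually_nhds_iff.1 hO0
      have hs1 : ∀ᶠ s in 𝓝 (0:ℝ), |s| * |Cb| < |1 - s| * δ := by
        refine ContinuousAt.eventually_lt (by fun_prop) (by fun_prop) (by simpa using hδ)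
      filter_upwards [hs1] with s hs v hv
      obtain ⟨r, hr, hx, h0, h⟩ := key s v hv
      have hx' : ∑ i, (r • Wv v) i ^ 2 = 1 := hx
      rw [Fin.sum_univ_succ] at hx'
      simp only [Wv, Pi.smul_apply, Fin.cons_zero, Fin.cons_succ, smul_eq_mul, mul_one] at hx'
      have hv' : v = Φ fun i => r * v i.succ := by
        have hq : 1 - ∑ i : Fin n, (r * v i.succ) ^ 2 = r ^ 2 := by linarith
        ext i
        refine Fin.cases ?_ (fun i => ?_) i
        · simp only [Φ, Fin.cons_zero, hq, h0]
        · simp only [Φ, Fin.cons_succ, hq, Real.sqrt_sq hr.le]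
          field_simp
      rw [hv']
      apply hδO
      rw [dist_zero_right, pi_norm_lt_iff hδ]
      intro i
      have b4 := h i
      have b6 : |s * G (r • Wv v) i| = |(1 - s) * (r * v i.succ)| := by
        rw [← abs_neg, show -(s * G (r • Wv v) i) = (1 - s) * (r * v i.succ) by linarith]
      rw [abs_mul, abs_mul] at b6
      have b7 := (hCb _ hx i).trans (le_abs_self _)
      have b8 : |1 - s| * |r * v i.succ| < |1 - s| * δ := by
        rw [← b6]
        exact (mul_le_mul_of_nonneg_left b7 (abs_nonneg s)).trans_lt hs
      exact lt_of_mul_lt_mul_left b8 (abs_nonneg _)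
  have d1 := (hD 1).and (mem_nhdsWithin_of_mem_nhds c1)
  have d0 := (hD 0).and (mem_nhdsWithin_of_mem_nhds c0)
  obtain ⟨s, h1, h1'⟩ := d1.exists
  obtain ⟨t, h0, h0'⟩ := d0.exists
  change (famZ I E s).ncard = 0 at h1'
  change (famZ I E t).ncard = 1 at h0'
  rw [h1'] at h1
  rw [h0'] at h0
  have := h1.trans h0.symm
  simp [Nat.ModEq] at this
end

section
open Topology Filter

lemma ext_equiv {X : Type} [AddCommGroup X] [Module ℝ X] [TopologicalSpace X] [ContinuousSMul ℝ X]
    (T : X → X) (hT : Continuous T) (hTT : ∀ x, T (T x) = x) (j : ℕ) :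
    ∃ f : (Fin (j+1) → ℝ) → X, ContinuousOn f {x | x ≠ 0} ∧ ∀ x, x ≠ 0 → f (-x) = T (f x) := by
  classical
  induction j with
  | zero =>
    refine ⟨fun x => if 0 < x 0 then 0 else T 0, ?_, ?_⟩
    · intro x hx
      have hx0 : x 0 ≠ 0 := by
        intro h; apply hx; ext i; rw [show i = 0 from Fin.fin_one_eq_zero i]; exact h
      refine ContinuousAt.continuousWithinAt ?_
      rcases lt_or_gt_of_ne hx0 with h | h
      · have : ∀ᶠ y : Fin 1 → ℝ in 𝓝 x, y 0 < 0 :=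
          (continuous_apply 0).continuousAt.eventually_lt continuousAt_const h
        refine (continuousAt_const (y := T 0)).congr ?_
        filter_upwards [this] with y hy
        rw [if_neg (not_lt.2 hy.le)]
      · have : ∀ᶠ y : Fin 1 → ℝ in 𝓝 x, 0 < y 0 :=
          continuousAt_const.eventually_lt (continuous_apply 0).continuousAt h
        refine (continuousAt_const (y := 0)).congr ?_
        filter_upwards [this] with y hy
        rw [if_pos hy]
    · intro x hx
      have hx0 : x 0 ≠ 0 := by
        intro h; apply hx; ext i; rw [show i = 0 from Fin.fin_one_eq_zero i]; exact h
      rcases lt_or_gt_of_ne hx0 with h | h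
      · simp [h, not_lt.2 h.le, hTT]
      · simp [h, not_lt.2 h.le]
  | succ j ih =>
    obtain ⟨f, hf, hfT⟩ := ih
    let tl : (Fin (j+2) → ℝ) → (Fin (j+1) → ℝ) := fun x i => x i.succ
    have htl : Continuous tl := continuous_pi fun i => continuous_apply _
    have htl0 : ∀ x, x ≠ 0 → tl x = 0 → x 0 ≠ 0 := by
      intro x hx h h0
      apply hx; ext i
      exact Fin.cases h0 (fun i => congrFun h i) i
    let c : (Fin (j+2) → ℝ) → ℝ := fun x => max (‖tl x‖ - x 0) 0 / (‖tl x‖ + x 0)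
    let h : (Fin (j+2) → ℝ) → X := fun x => c x • f (tl x)
    have hh : ContinuousOn h {x | x ≠ 0 ∧ 0 ≤ x 0} := by
      rintro x ⟨hx, hx0⟩
      refine ContinuousAt.continuousWithinAt ?_
      by_cases h0 : tl x = 0
      · have hpos : 0 < x 0 := lt_of_le_of_ne hx0 (htl0 x hx h0).symm
        have : ∀ᶠ y in 𝓝 x, ‖tl y‖ < y 0 :=
          htl.norm.continuousAt.eventually_lt (continuous_apply 0).continuousAt (by simpa [h0] using hpos)
        refine (continuousAt_const (y := 0)).congr ?_
        filter_upwards [this] with y hy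
        simp only [h, c]
        rw [max_eq_right (by linarith), zero_div, zero_smul]
      · have hn : 0 < ‖tl x‖ := norm_pos_iff.2 h0
        have hc : ContinuousAt c x := by
          refine ContinuousAt.div ?_ ?_ (by linarith)
          · exact ((htl.norm.sub (continuous_apply 0)).max continuous_const).continuousAt
          · exact (htl.norm.add (continuous_apply 0)).continuousAt
        have hfc : ContinuousAt f (tl x) :=
          hf.continuousAt (isOpen_ne.mem_nhds h0)
        exact hc.smul (ContinuousAt.comp hfc htl.continuousAt)
    have hagree : ∀ x, x ≠ 0 → x 0 = 0 → h x = f (tl x) := by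
      intro x hx hx0
      have hn : ‖tl x‖ ≠ 0 := by
        rw [norm_ne_zero_iff]; intro h; exact htl0 x hx h hx0
      simp only [h, c, hx0, sub_zero, add_zero]
      rw [max_eq_left (norm_nonneg _), div_self hn, one_smul]
    have hag2 : ∀ x, x ≠ 0 → x 0 = 0 → h x = T (h (-x)) := by
      intro x hx hx0
      rw [hagree x hx hx0, hagree (-x) (neg_ne_zero.2 hx) (by simp [hx0])]
      have : tl (-x) = - tl x := rfl
      rw [this, hfT, hTT]
      intro h; exact htl0 x hx h hx0
    refine ⟨fun x => if 0 ≤ x 0 then h x else T (h (-x)), ?_, ?_⟩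
    · refine ContinuousOn.if ?_ ?_ ?_
      · rintro x ⟨hx, hx2⟩
        have := frontier_le_subset_eq continuous_const (continuous_apply 0) hx2
        exact hag2 x hx this.symm
      · refine hh.mono ?_
        rintro x ⟨hx, hx2⟩
        exact ⟨hx, (isClosed_le continuous_const (continuous_apply 0)).closure_subset hx2⟩
      · refine hT.comp_continuousOn (hh.comp continuous_neg.continuousOn ?_)
        rintro x ⟨hx, hx2⟩
        have : x 0 ≤ 0 := by
          refine (isClosed_le (continuous_apply 0) continuous_const).closure_subset_iff.2 ?_ hx2
          intro y hy
          exact (not_le.1 hy).le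
        refine ⟨neg_ne_zero.2 hx, ?_⟩
        simpa using this
    · intro x hx
      rcases lt_trichotomy (x 0) 0 with h0 | h0 | h0
      · have a : (0 ≤ (-x) 0) := by simpa using h0.le
        simp only
        rw [if_pos a, if_neg (not_le.2 h0), hTT]
      · have a : (0 ≤ (-x) 0) := by simp [h0]
        simp only
        rw [if_pos a, if_pos h0.ge, hag2 x hx h0, hTT]
      · have a : ¬ (0 ≤ (-x) 0) := by simpa using h0
        simp only
        rw [if_neg a, if_pos h0.le, neg_neg]

lemma no_free_involution {n : ℕ} (T : (Fin n → ℝ) → (Fin n → ℝ)) (hT : Continuous T)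
    (hTT : ∀ x, T (T x) = x) (hfix : ∀ x, T x ≠ x) : False := by
  obtain ⟨f, hf, hfT⟩ := ext_equiv T hT hTT n
  refine borsuk_ulam (fun x => f x - f (-x)) ?_ ?_ ?_
  · refine hf.sub (hf.comp continuous_neg.continuousOn ?_)
    intro x hx; exact neg_ne_zero.2 hx
  · intro x hx; simp
  · intro x hx h
    rw [hfT x hx, sub_eq_zero] at h
    exact hfix _ h.symm
end

section
open Topology Filter

section deck
variable {n : ℕ} {F : (Fin n → ℝ) → (Fin n → ℝ)}

lemma range_closedMap (hF : Continuous F)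
    (hP : ∀ y ∈ Set.range F, ∃ K ∈ 𝓝 y, IsCompact K ∧ IsCompact (F ⁻¹' K)) :
    IsClosedMap (Set.rangeFactorization F) := by
  intro C hC
  refine isClosed_of_closure_subset fun y hy => ?_
  rw [closure_subtype] at hy
  obtain ⟨K, hK, hKc, hKp⟩ := hP y.1 y.2
  have e : Subtype.val '' (Set.rangeFactorization F '' C) = F '' C := by
    rw [← Set.image_comp]; rfl
  rw [e] at hy
  have h1 : y.1 ∈ closure (K ∩ F '' C) := by
    rw [mem_closure_iff_nhds] at hy ⊢
    intro t ht
    have := hy (t ∩ K) (inter_mem ht hK)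
    rwa [Set.inter_assoc] at this
  have h2 : K ∩ F '' C ⊆ F '' (F ⁻¹' K ∩ C) := by
    rintro _ ⟨hk, x, hx, rfl⟩
    exact ⟨x, ⟨hk, hx⟩, rfl⟩
  have h3 : IsClosed (F '' (F ⁻¹' K ∩ C)) := ((hKp.inter_right hC).image hF).isClosed
  obtain ⟨x, hx, hxy⟩ := closure_minimal h2 h3 h1
  exact ⟨x, hx.2, Subtype.ext hxy⟩

lemma range_fin (hL : IsLocalHomeomorph F)
    (hP : ∀ y ∈ Set.range F, ∃ K ∈ 𝓝 y, IsCompact K ∧ IsCompact (F ⁻¹' K)) (y : Fin n → ℝ)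
    (hy : y ∈ Set.range F) : (F ⁻¹' {y}).Finite := by
  obtain ⟨K, hK, hKc, hKp⟩ := hP y hy
  have h1 : IsCompact (F ⁻¹' {y}) :=
    hKp.of_isClosed_subset (isClosed_singleton.preimage hL.continuous)
      (Set.preimage_mono (Set.singleton_subset_iff.2 (mem_of_mem_nhds hK)))
  refine h1.finite (IsDiscrete.of_openPartialHomeomorph F subset_rfl ?_)
  intro e _
  obtain ⟨φ, h, h'⟩ := hL e
  exact ⟨φ, h, h'.symm⟩

lemma range_cover (hL : IsLocalHomeomorph F)
    (hP : ∀ y ∈ Set.range F, ∃ K ∈ 𝓝 y, IsCompact K ∧ IsCompact (F ⁻¹' K)) :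
    IsCoveringMap (Set.rangeFactorization F) := by
  rw [isCoveringMap_iff_isCoveringMapOn_univ]
  refine (range_closedMap hL.continuous hP).isCoveringMapOn_of_isLocalHomeomorphOn ?_ ?_
  · intro y _
    refine (range_fin hL hP y.1 y.2).subset ?_
    intro x hx
    exact congrArg Subtype.val hx
  · have : IsLocalHomeomorph (Set.rangeFactorization F) := by
      refine IsLocalHomeomorph.of_comp (g := Subtype.val) ?_ ?_ ?_
      · exact hL
      · exact (hL.isOpenMap.isOpen_range.isOpenEmbedding_subtypeVal).isLocalHomeomorph
      · exact hL.continuous.rangeFactorization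
    exact this.isLocalHomeomorphOn.mono (Set.subset_univ _)

/-- deck group -/
def deckG (F : (Fin n → ℝ) → (Fin n → ℝ)) : Subgroup ((Fin n → ℝ) ≃ₜ (Fin n → ℝ)) where
  carrier := {T | ∀ x, F (T x) = F x}
  one_mem' := fun x => rfl
  mul_mem' := by
    intro a b ha hb x
    change F (a (b x)) = F x
    rw [ha, hb]
  inv_mem' := by
    intro a ha x
    change F (a.symm x) = F x
    rw [← ha, a.apply_symm_apply]

lemma deck_uniq (hL : IsLocalHomeomorph F)
    (hP : ∀ y ∈ Set.range F, ∃ K ∈ 𝓝 y, IsCompact K ∧ IsCompact (F ⁻¹' K))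
    (S T : (Fin n → ℝ) → (Fin n → ℝ)) (hS : Continuous S) (hT : Continuous T)
    (hSF : ∀ x, F (S x) = F x) (hTF : ∀ x, F (T x) = F x) (x : Fin n → ℝ) (h : S x = T x) : S = T := by
  refine (range_cover hL hP).eq_of_comp_eq hS hT ?_ x h
  ext1 z
  exact Subtype.ext ((hSF z).trans (hTF z).symm)

lemma deck_exists (hL : IsLocalHomeomorph F)
    (hP : ∀ y ∈ Set.range F, ∃ K ∈ 𝓝 y, IsCompact K ∧ IsCompact (F ⁻¹' K))
    (x x' : Fin n → ℝ) (h : F x = F x') : ∃ T : deckG F, T.1 x = x' := by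
  have key : ∀ x x' : Fin n → ℝ, F x = F x' →
      ∃ T : (Fin n → ℝ) → (Fin n → ℝ), Continuous T ∧ T x = x' ∧ ∀ z, F (T z) = F z := by
    intro x x' h
    obtain ⟨T, ⟨h1, h2⟩, -⟩ := (range_cover hL hP).existsUnique_continuousMap_lifts
      ⟨Set.rangeFactorization F, hL.continuous.rangeFactorization⟩ x x' (Subtype.ext h.symm)
    exact ⟨T, T.continuous, h1, fun z => congrArg Subtype.val (congrFun h2 z)⟩
  obtain ⟨T, hT, hTx, hTF⟩ := key x x' h
  obtain ⟨S, hS, hSx, hSF⟩ := key x' x h.symm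
  have e1 : S ∘ T = id := deck_uniq hL hP _ _ (hS.comp hT) continuous_id
    (fun z => by simp [hSF, hTF]) (fun z => rfl) x (by simp [hTx, hSx])
  have e2 : T ∘ S = id := deck_uniq hL hP _ _ (hT.comp hS) continuous_id
    (fun z => by simp [hSF, hTF]) (fun z => rfl) x' (by simp [hTx, hSx])
  exact ⟨⟨⟨⟨T, S, congrFun e1, congrFun e2⟩, hT, hS⟩, hTF⟩, hTx⟩

theorem fibre_odd (hL : IsLocalHomeomorph F)
    (hP : ∀ y ∈ Set.range F, ∃ K ∈ 𝓝 y, IsCompact K ∧ IsCompact (F ⁻¹' K)) :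
    ∃ d : ℕ, Odd d ∧ ∀ y ∈ Set.range F, (F ⁻¹' {y}).Finite ∧ (F ⁻¹' {y}).ncard = d := by
  have huq : ∀ S T : deckG F, ∀ x, S.1 x = T.1 x → S = T := by
    intro S T x h
    have := deck_uniq hL hP S.1 T.1 S.1.continuous T.1.continuous S.2 T.2 x h
    exact Subtype.ext (Homeomorph.ext (congrFun this))
  have hcard : ∀ x, Nat.card (deckG F) = (F ⁻¹' {F x}).ncard := by
    intro x
    refine Nat.card_congr (Equiv.ofBijective (fun T => ⟨T.1 x, T.2 x⟩) ⟨?_, ?_⟩)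
    · intro S T h
      exact huq S T x (congrArg Subtype.val h)
    · rintro ⟨z, hz⟩
      obtain ⟨T, hT⟩ := deck_exists hL hP x z (Eq.symm hz)
      exact ⟨T, Subtype.ext hT⟩
  refine ⟨Nat.card (deckG F), ?_, ?_⟩
  · rw [← Nat.not_even_iff_odd]
    intro hev
    have hfin := range_fin hL hP (F 0) ⟨0, rfl⟩
    haveI : Finite (deckG F) := by
      refine Nat.finite_of_card_ne_zero ?_
      rw [hcard 0]
      exact (Set.ncard_pos hfin).2 ⟨0, rfl⟩ |>.ne'
    haveI : Fact (Nat.Prime 2) := ⟨Nat.prime_two⟩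
    obtain ⟨T, hT⟩ := exists_prime_orderOf_dvd_card' 2 hev.two_dvd
    have hT2 : T ^ 2 = 1 := by rw [← hT]; exact pow_orderOf_eq_one T
    have hT1 : T ≠ 1 := by
      rintro rfl
      simp at hT
    refine no_free_involution T.1 T.1.continuous (fun x => ?_) (fun x hx => ?_)
    · have : (T ^ 2).1 x = x := by rw [hT2]; rfl
      rwa [pow_two] at this
    · exact hT1 (huq T 1 x hx)
  · rintro _ ⟨x, rfl⟩
    exact ⟨range_fin hL hP _ ⟨x, rfl⟩, (hcard x).symm⟩
end deck
end

section
open Topology Filter MvPolynomial IsLocalRing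

lemma cot_expand_gen {n : ℕ} (P : Type) [CommRing P] [IsLocalRing P] [Algebra ℝ P]
    [Algebra.FormallySmooth ℝ (ResidueField P)] (α0 : MvPolynomial (Fin n) ℝ →ₐ[ℝ] P) :
    ∃ u : Fin n → P, (∀ k, u k ∈ maximalIdeal P) ∧
      ∀ f, α0 f ∈ maximalIdeal P → α0 f - ∑ k, α0 (pderiv k f) * u k ∈ (maximalIdeal P) ^ 2 := by
  classical
  let m := maximalIdeal P
  let κ := ResidueField P
  let g : (P ⧸ m ^ 2) →ₐ[ℝ] κ := Ideal.Quotient.liftₐ (m ^ 2) (IsScalarTower.toAlgHom ℝ P κ) (by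
    intro a ha
    have : a ∈ m := Ideal.pow_le_self two_ne_zero ha
    exact (residue_eq_zero_iff a).2 this)
  have hg1 : ∀ a : P, g (Ideal.Quotient.mk _ a) = residue P a := fun a => rfl
  have hg : Function.Surjective g := by
    intro x
    obtain ⟨a, rfl⟩ := residue_surjective x
    exact ⟨Ideal.Quotient.mk _ a, rfl⟩
  have hker : ∀ z, g z = 0 → ∃ a ∈ m, Ideal.Quotient.mk (m ^ 2) a = z := by
    intro z hz
    obtain ⟨a, rfl⟩ := Ideal.Quotient.mk_surjective z
    exact ⟨a, (residue_eq_zero_iff a).1 hz, rfl⟩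
  have hsq : ∀ z w, g z = 0 → g w = 0 → z * w = 0 := by
    intro z w hz hw
    obtain ⟨a, ha, rfl⟩ := hker z hz
    obtain ⟨b, hb, rfl⟩ := hker w hw
    rw [← map_mul, Ideal.Quotient.eq_zero_iff_mem, pow_two]
    exact Ideal.mul_mem_mul ha hb
  have hnil : IsNilpotent (RingHom.ker (g : (P ⧸ m ^ 2) →+* κ)) := by
    refine ⟨2, ?_⟩
    rw [pow_two (RingHom.ker _), Ideal.zero_eq_bot, eq_bot_iff, Ideal.mul_le]
    intro r hr s hs
    exact hsq r s hr hs
  let s : κ →ₐ[ℝ] (P ⧸ m ^ 2) := Algebra.FormallySmooth.liftOfSurjective (AlgHom.id ℝ κ) g hg hnil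
  have hs : ∀ x, g (s x) = x := fun x =>
    Algebra.FormallySmooth.liftOfSurjective_apply (AlgHom.id ℝ κ) g hg hnil x
  let α : MvPolynomial (Fin n) ℝ →ₐ[ℝ] (P ⧸ m ^ 2) :=
    (Ideal.Quotient.mkₐ ℝ (m ^ 2)).comp α0
  let β : MvPolynomial (Fin n) ℝ →ₐ[ℝ] (P ⧸ m ^ 2) := s.comp (g.comp α)
  let U : Fin n → (P ⧸ m ^ 2) := fun k => α (X k) - β (X k)
  have hU : ∀ k, g (U k) = 0 := by
    intro k
    simp only [U, map_sub, β, AlgHom.comp_apply, hs, sub_self]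
  have key : ∀ f, α f - β f = ∑ k, α (pderiv k f) * U k := by
    intro f
    induction f using MvPolynomial.induction_on with
    | C a =>
      simp only [pderiv_C, map_zero, zero_mul, Finset.sum_const_zero]
      rw [← MvPolynomial.algebraMap_eq, AlgHom.commutes, AlgHom.commutes, sub_self]
    | add p q hp hq =>
      simp only [map_add, add_mul, Finset.sum_add_distrib, ← hp, ← hq]; ring
    | mul_X p i hp =>
      have e1 : ∑ k, α (pderiv k (p * X i)) * U k = α p * U i + α (X i) * ∑ k, α (pderiv k p) * U k := by
        simp only [Derivation.leibniz, pderiv_X, smul_eq_mul, map_add, map_mul, add_mul,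
          Finset.sum_add_distrib, Finset.mul_sum]
        congr 1
        · rw [Finset.sum_eq_single i]
          · simp
          · intro j _ hj
            simp [Pi.single_apply, hj.symm]
          · intro h; exact absurd (Finset.mem_univ i) h
        · refine Finset.sum_congr rfl fun k _ => by ring
      have e2 : (∑ k, α (pderiv k p) * U k) * U i = 0 := by
        rw [Finset.sum_mul]
        refine Finset.sum_eq_zero fun k _ => ?_
        rw [mul_assoc, hsq _ _ (hU k) (hU i), mul_zero]
      rw [e1, ← hp] at *
      rw [map_mul, map_mul]
      have e3 : β (X i) = α (X i) - U i := by simp [U]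
      rw [e3]
      linear_combination -e2
  choose u hu huU using fun k => hker (U k) (hU k)
  refine ⟨u, hu, fun f hf => ?_⟩
  rw [← Ideal.Quotient.eq_zero_iff_mem]
  have hβ : β f = 0 := by
    have : g (α f) = 0 := by
      change residue P (α0 f) = 0
      rw [residue_eq_zero_iff]
      exact hf
    simp only [β, AlgHom.comp_apply, this, map_zero]
  have := key f
  rw [hβ, sub_zero] at this
  rw [map_sub, map_sum, sub_eq_zero]
  simp only [← huU] at this
  simp only [map_mul]
  exact this

lemma cot_expand {n : ℕ} (𝔭 : Ideal (MvPolynomial (Fin n) ℝ)) [𝔭.IsPrime] :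
    ∃ u : Fin n → Localization.AtPrime 𝔭, (∀ k, u k ∈ maximalIdeal (Localization.AtPrime 𝔭)) ∧
      ∀ f ∈ 𝔭, algebraMap _ (Localization.AtPrime 𝔭) f -
        ∑ k, algebraMap _ (Localization.AtPrime 𝔭) (pderiv k f) * u k ∈
          (maximalIdeal (Localization.AtPrime 𝔭)) ^ 2 := by
  haveI : Algebra.EssFiniteType ℝ (Localization.AtPrime 𝔭) := .comp _ (MvPolynomial (Fin n) ℝ) _
  haveI : Algebra.EssFiniteType ℝ (ResidueField (Localization.AtPrime 𝔭)) :=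
    .comp _ (Localization.AtPrime 𝔭) _
  haveI : Algebra.FormallySmooth ℝ (ResidueField (Localization.AtPrime 𝔭)) := inferInstance
  obtain ⟨u, hu, h⟩ := cot_expand_gen (Localization.AtPrime 𝔭)
    (IsScalarTower.toAlgHom ℝ (MvPolynomial (Fin n) ℝ) (Localization.AtPrime 𝔭))
  exact ⟨u, hu, fun f hf => h f
    ((IsLocalization.AtPrime.to_map_mem_maximal_iff (Localization.AtPrime 𝔭) 𝔭 f).2 hf)⟩

/-- generic smoothness data -/
lemma smooth_data {n : ℕ} (𝔭 : Ideal (MvPolynomial (Fin n) ℝ)) [𝔭.IsPrime] :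
    ∃ (m : ℕ) (f : Fin m → MvPolynomial (Fin n) ℝ) (N : Fin n → Fin m → MvPolynomial (Fin n) ℝ)
      (h g : MvPolynomial (Fin n) ℝ), (∀ i, f i ∈ 𝔭) ∧ h ∉ 𝔭 ∧ g ∉ 𝔭 ∧
      (∀ i j, ∑ k, pderiv k (f i) * N k j - (if i = j then h else 0) ∈ 𝔭) ∧
      (∀ e ∈ 𝔭, g * e ∈ Ideal.span (Set.range f)) := by
  classical
  let P := Localization.AtPrime 𝔭
  let φ : MvPolynomial (Fin n) ℝ →+* P := algebraMap _ P
  have hφ : ∀ f ∈ 𝔭, φ f ∈ maximalIdeal P := fun f hf =>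
    (IsLocalization.AtPrime.to_map_mem_maximal_iff P 𝔭 f).2 hf
  have hφ' : ∀ f, φ f ∈ maximalIdeal P → f ∈ 𝔭 := fun f hf =>
    (IsLocalization.AtPrime.to_map_mem_maximal_iff P 𝔭 f).1 hf
  haveI : IsNoetherianRing P := IsLocalization.isNoetherianRing 𝔭.primeCompl P inferInstance
  obtain ⟨u, hu, hexp⟩ := cot_expand 𝔭
  let tc : maximalIdeal P →ₗ[P] CotangentSpace P := (maximalIdeal P).toCotangent
  let S : Set (maximalIdeal P) := Set.range fun f : 𝔭 => ⟨φ f.1, hφ f.1 f.2⟩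
  have hS : Submodule.span P S = ⊤ := by
    rw [← (Submodule.map_injective_of_injective (maximalIdeal P).injective_subtype).eq_iff]
    rw [Submodule.map_span, Submodule.map_top, Submodule.range_subtype]
    refine Eq.trans ?_ Localization.AtPrime.map_eq_maximalIdeal
    rw [Ideal.map]
    change Submodule.span P _ = Submodule.span P _
    congr 1
    ext z
    constructor
    · rintro ⟨_, ⟨f, rfl⟩, rfl⟩
      exact ⟨f.1, f.2, rfl⟩
    · rintro ⟨f, hf, rfl⟩
      exact ⟨_, ⟨⟨f, hf⟩, rfl⟩, rfl⟩
  have hS2 : Submodule.span (ResidueField P) (tc '' S) = ⊤ :=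
    CotangentSpace.span_image_eq_top_iff.2 hS
  obtain ⟨b, hb, hbs, hbl⟩ := exists_linearIndependent (ResidueField P) (tc '' S)
  rw [hS2] at hbs
  have hbf : b.Finite := hbl.setFinite
  haveI := hbf.fintype
  let m := Fintype.card b
  let ε : Fin m ≃ b := (Fintype.equivFin b).symm
  have h1 : ∀ i : Fin m, ∃ f : 𝔭, tc ⟨φ f.1, hφ f.1 f.2⟩ = (ε i).1 := by
    intro i
    obtain ⟨_, ⟨f, rfl⟩, h⟩ := hb (ε i).2
    exact ⟨f, h⟩
  choose f hf using h1
  have hli : LinearIndependent (ResidueField P) (fun i => (ε i).1) := hbl.comp ε ε.injective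
  have hsp : Submodule.span (ResidueField P) (Set.range fun i => (ε i).1) = ⊤ := by
    rw [← hbs]
    congr 1
    ext z
    constructor
    · rintro ⟨i, rfl⟩; exact (ε i).2
    · intro hz; exact ⟨ε.symm ⟨z, hz⟩, by simp⟩
  let B : Module.Basis (Fin m) (ResidueField P) (CotangentSpace P) := Module.Basis.mk hli hsp.ge
  have hB : ∀ i, B i = (ε i).1 := fun i => by simp [B]
  -- coefficients
  have hnu : ∀ k j, ∃ c : P, residue P c = B.repr (tc ⟨u k, hu k⟩) j := fun k j =>
    residue_surjective _
  choose c hc using hnu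
  obtain ⟨h, hh⟩ := IsLocalization.exist_integer_multiples_of_finite 𝔭.primeCompl
    (fun kj : Fin n × Fin m => c kj.1 kj.2)
  have hh' : ∀ k j, ∃ N : MvPolynomial (Fin n) ℝ, φ N = φ h.1 * c k j := by
    intro k j
    obtain ⟨N, hN⟩ := hh (k, j)
    refine ⟨N, ?_⟩
    rw [Algebra.smul_def] at hN
    exact hN
  choose N hN using hh'
  have hker : ∀ p, residue P (φ p) = 0 → p ∈ 𝔭 := fun p hp =>
    hφ' p ((residue_eq_zero_iff _).1 hp)
  -- relation
  have hrel : ∀ i j, ∑ k, residue P (φ (pderiv k (f i).1)) * residue P (c k j) = if i = j then 1 else 0 := by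
    intro i j
    have e1 : tc ⟨φ (f i).1, hφ _ (f i).2⟩ = ∑ k, residue P (φ (pderiv k (f i).1)) • tc ⟨u k, hu k⟩ := by
      have : ∑ k, residue P (φ (pderiv k (f i).1)) • tc ⟨u k, hu k⟩ =
          tc (∑ k, φ (pderiv k (f i).1) • ⟨u k, hu k⟩) := by
        rw [map_sum]
        refine Finset.sum_congr rfl fun k _ => ?_
        rw [map_smul]
        rfl
      rw [this, Ideal.toCotangent_eq]
      have := hexp (f i).1 (f i).2
      convert this using 2
      simp
      rfl
    rw [hf, ← hB] at e1
    have e2 := congrArg (fun z => B.repr z j) e1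
    simp only [Module.Basis.repr_self, map_sum, map_smul, Finsupp.coe_finset_sum, Finset.sum_apply,
      Finsupp.smul_apply, smul_eq_mul, ← hc] at e2
    rw [← e2, Finsupp.single_apply]
  refine ⟨m, fun i => (f i).1, N, h.1, ?_⟩
  -- the ideal
  let J := Ideal.span (Set.range fun i => (f i).1)
  have hJ : J.map φ = maximalIdeal P := by
    have e : Submodule.span P (Set.range fun i : Fin m => (⟨φ (f i).1, hφ _ (f i).2⟩ : maximalIdeal P)) = ⊤ := by
      rw [← CotangentSpace.span_image_eq_top_iff, ← hsp, ← Set.range_comp]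
      congr 2
      ext1 i
      exact hf i
    rw [← (Submodule.map_injective_of_injective (maximalIdeal P).injective_subtype).eq_iff] at e
    rw [Submodule.map_span, Submodule.map_top, Submodule.range_subtype, ← Set.range_comp] at e
    rw [← e, Ideal.map_span, ← Set.range_comp]
    rfl
  have hloc : ∀ e ∈ 𝔭, ∃ t, t ∉ 𝔭 ∧ t * e ∈ J := by
    intro e he
    have := hφ e he
    rw [← hJ] at this
    obtain ⟨t, ht, hte⟩ := (IsLocalization.algebraMap_mem_map_algebraMap_iff 𝔭.primeCompl P _ _).1 this
    exact ⟨t, ht, hte⟩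
  have hall : ∃ g, g ∉ 𝔭 ∧ ∀ e ∈ 𝔭, g * e ∈ J := by
    obtain ⟨s, hs⟩ := (IsNoetherian.noetherian 𝔭 : 𝔭.FG)
    have hs' : ∀ e ∈ s, e ∈ 𝔭 := fun e he => by rw [← hs]; exact Submodule.subset_span he
    choose! t ht hte using hloc
    refine ⟨∏ e ∈ s, t e, ?_, ?_⟩
    · intro hmem
      rw [(inferInstance : 𝔭.IsPrime).prod_mem_iff] at hmem
      obtain ⟨e, he, hee⟩ := hmem
      exact ht e (hs' e he) hee
    · intro e he
      rw [← hs] at he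
      refine Submodule.span_induction ?_ ?_ ?_ ?_ he
      · intro x hx
        rw [← Finset.mul_prod_erase s t hx, mul_right_comm]
        exact J.mul_mem_right _ (hte x (hs' x hx))
      · simp
      · intro x y _ _ hx hy; rw [mul_add]; exact J.add_mem hx hy
      · intro a x _ hx; rw [smul_eq_mul, mul_left_comm]; exact J.mul_mem_left _ hx
  obtain ⟨g, hg, hgJ⟩ := hall
  refine ⟨g, fun i => (f i).2, h.2, hg, ?_, hgJ⟩
  intro i j
  apply hker
  simp only [map_sub, map_sum, map_mul, hN]
  have := hrel i j
  have e3 : ∑ k, residue P (φ (pderiv k (f i).1)) * (residue P (φ h.1) * residue P (c k j)) =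
      residue P (φ h.1) * (if i = j then 1 else 0) := by
    rw [← this, Finset.mul_sum]
    exact Finset.sum_congr rfl fun k _ => by ring
  rw [e3]
  split_ifs <;> simp
end

section
open Topology Filter MvPolynomial

lemma local_prime {n : ℕ} (A : Set (Fin n → ℝ)) (hA : A.Nonempty) :
    ∃ 𝔭 : Ideal (MvPolynomial (Fin n) ℝ), 𝔭.IsPrime ∧
      ∃ O, IsOpen O ∧ (∀ y ∈ A ∩ O, ∀ f ∈ 𝔭, eval y f = 0) ∧
      ∀ g, g ∉ 𝔭 → ∃ a ∈ A ∩ O, eval a g ≠ 0 := by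
  classical
  let V : Set (Fin n → ℝ) → Ideal (MvPolynomial (Fin n) ℝ) := fun S => ⨅ x ∈ S, RingHom.ker (eval x)
  have hV : ∀ S f, f ∈ V S ↔ ∀ x ∈ S, eval x f = 0 := by
    intro S f; simp [V, Ideal.mem_iInf, RingHom.mem_ker]
  let 𝒮 : Set (Ideal (MvPolynomial (Fin n) ℝ)) := {J | ∃ O, IsOpen O ∧ (A ∩ O).Nonempty ∧ J = V (A ∩ O)}
  have h𝒮 : 𝒮.Nonempty := ⟨_, Set.univ, isOpen_univ, by simpa using hA, rfl⟩
  obtain ⟨𝔭, ⟨O, hO, hAO, rfl⟩, hmax⟩ := set_has_maximal_iff_noetherian.2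
    (inferInstance : IsNoetherian (MvPolynomial (Fin n) ℝ) (MvPolynomial (Fin n) ℝ)) 𝒮 h𝒮
  have hmax' : ∀ O', IsOpen O' → O' ⊆ O → (A ∩ O').Nonempty → V (A ∩ O') = V (A ∩ O) := by
    intro O' hO' hsub hne
    have h1 : V (A ∩ O) ≤ V (A ∩ O') := by
      intro f hf
      rw [hV] at hf ⊢
      exact fun x hx => hf x ⟨hx.1, hsub hx.2⟩
    by_contra hcon
    exact hmax _ ⟨O', hO', hne, rfl⟩ (lt_of_le_of_ne h1 (Ne.symm hcon))
  refine ⟨V (A ∩ O), ?_, O, hO, fun y hy f hf => (hV _ _).1 hf y hy, ?_⟩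
  · refine ⟨?_, ?_⟩
    · intro htop
      obtain ⟨a, ha⟩ := hAO
      have : (1 : MvPolynomial (Fin n) ℝ) ∈ V (A ∩ O) := by rw [htop]; trivial
      rw [hV] at this
      simpa using this a ha
    · intro f g hfg
      by_contra hcon
      push Not at hcon
      obtain ⟨hf, hg⟩ := hcon
      rw [hV] at hf
      push Not at hf
      obtain ⟨a, ha, haf⟩ := hf
      apply hg
      have hop : IsOpen (O ∩ {x | eval x f ≠ 0}) :=
        hO.inter (isOpen_ne_fun (continuous_eval f) continuous_const)
      rw [← hmax' (O ∩ {x | eval x f ≠ 0}) hop Set.inter_subset_left ⟨a, ha.1, ha.2, haf⟩, hV]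
      rintro x ⟨hx, hxO, hxf⟩
      have := (hV _ _).1 hfg x ⟨hx, hxO⟩
      rw [map_mul] at this
      exact (mul_eq_zero.1 this).resolve_left hxf
  · intro g hg
    rw [hV] at hg
    push Not at hg
    obtain ⟨a, ha, hag⟩ := hg
    exact ⟨a, ha, hag⟩

lemma eval_hasFDeriv {σ : Type} [Fintype σ] (f : MvPolynomial σ ℝ) (x : σ → ℝ) :
    HasFDerivAt (fun x : σ → ℝ => eval x f)
      (∑ j, eval x (pderiv j f) • (ContinuousLinearMap.proj j : (σ → ℝ) →L[ℝ] ℝ)) x := by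
  have := fev_hasFDeriv (map Polynomial.C f) 0 x
  simp only [fev_map, pderiv_map] at this
  exact this

section
variable {n : ℕ} {F : (Fin n → ℝ) → (Fin n → ℝ)} {p q : Fin n → MvPolynomial (Fin n) ℝ}

lemma rat_contDiff (hq : ∀ i x, eval x (q i) ≠ 0) (hF : ∀ x i, F x i = eval x (p i) / eval x (q i)) :
    ContDiff ℝ 1 F := by
  have hcd : ∀ f : MvPolynomial (Fin n) ℝ, ContDiff ℝ 1 (fun x => eval x f) := by
    intro f
    have := (fev_contDiff (map Polynomial.C f)).comp (contDiff_prodMk_right (n := 1) (0:ℝ) (F := Fin n → ℝ))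
    simp only [Function.comp_def, fev_map] at this
    exact this
  rw [contDiff_pi]
  intro i
  have : (fun x => F x i) = fun x => eval x (p i) / eval x (q i) := funext fun x => hF x i
  rw [this]
  exact (hcd _).div (hcd _) (hq i)

lemma graph_det (hq : ∀ i x, eval x (q i) ≠ 0) (hF : ∀ x i, F x i = eval x (p i) / eval x (q i))
    (hjac : ∀ x, (fderiv ℝ F x).det ≠ 0) (x : Fin n → ℝ) :
    (Matrix.of fun i j => eval x (pderiv j (p i)) - F x i * eval x (pderiv j (q i))).det ≠ 0 := by
  classical
  have hd := (rat_contDiff hq hF).differentiable one_ne_zero x |>.hasFDerivAt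
  let J : Matrix (Fin n) (Fin n) ℝ := LinearMap.toMatrix' (fderiv ℝ F x : (Fin n → ℝ) →ₗ[ℝ] (Fin n → ℝ))
  have hJ : J.det ≠ 0 := by
    have : J.det = (fderiv ℝ F x).det := by
      rw [ContinuousLinearMap.det, ← LinearMap.det_toMatrix']
    rw [this]; exact hjac x
  have hM : (Matrix.of fun i j => eval x (pderiv j (p i)) - F x i * eval x (pderiv j (q i))) =
      Matrix.diagonal (fun i => eval x (q i)) * J := by
    ext i j
    rw [Matrix.diagonal_mul, Matrix.of_apply]
    have h1 : HasFDerivAt (fun x => F x i) ((ContinuousLinearMap.proj i).comp (fderiv ℝ F x)) x :=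
      (hasFDerivAt_pi'.1 hd) i
    have h2 := h1.mul (eval_hasFDeriv (q i) x)
    have h3 : ((fun x => F x i) * fun x => eval x (q i)) = fun x => eval x (p i) := by
      funext x; simp only [Pi.mul_apply]; rw [hF, div_mul_cancel₀ _ (hq i x)]
    rw [h3] at h2
    have h4 := (eval_hasFDeriv (p i) x).unique h2
    have h5 := congrArg (fun L => L (Pi.single j 1)) h4
    simp [Pi.single_apply] at h5
    rw [h5]
    have : J i j = fderiv ℝ F x (Pi.single j 1) i := by
      simp [J, LinearMap.toMatrix'_apply]
    rw [this]; ring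
  rw [hM, Matrix.det_mul, Matrix.det_diagonal]
  exact mul_ne_zero (Finset.prod_ne_zero_iff.2 fun i _ => hq i x) hJ

lemma graph_iff (hq : ∀ i x, eval x (q i) ≠ 0) (hF : ∀ x i, F x i = eval x (p i) / eval x (q i))
    (x : Fin n → ℝ) (i) (y : ℝ) : eval x (p i) - y * eval x (q i) = 0 ↔ F x i = y := by
  rw [hF, div_eq_iff (hq i x), sub_eq_zero]

lemma fibre_parity (hq : ∀ i x, eval x (q i) ≠ 0) (hF : ∀ x i, F x i = eval x (p i) / eval x (q i))
    (hjac : ∀ x, (fderiv ℝ F x).det ≠ 0) (𝔭 : Ideal (MvPolynomial (Fin n) ℝ)) [𝔭.IsPrime] :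
    ∃ Q, Q ∉ 𝔭 ∧ ∃ D : ℕ, ∀ y, (∀ f ∈ 𝔭, eval y f = 0) → eval y Q ≠ 0 →
      (F ⁻¹' {y}).ncard ≡ D [MOD 2] := by
  classical
  let B := MvPolynomial (Fin n) ℝ ⧸ 𝔭
  let mk : MvPolynomial (Fin n) ℝ →+* B := Ideal.Quotient.mk 𝔭
  let c : ℝ →+* B := mk.comp C
  let P : Fin n → MvPolynomial (Fin n) B := fun i => map c (p i) - C (mk (X i)) * map c (q i)
  let E := (Matrix.of fun i j => pderiv j (P i)).det
  obtain ⟨Q, hQ, D, h⟩ := parity_core (Ideal.span (Set.range P)) P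
    (fun i => Ideal.subset_span ⟨i, rfl⟩) E dvd_rfl
  obtain ⟨Q, rfl⟩ := Ideal.Quotient.mk_surjective Q
  refine ⟨Q, fun hmem => hQ (Ideal.Quotient.eq_zero_iff_mem.2 hmem), D, fun y hy hyQ => ?_⟩
  let χ : B →+* ℝ := Ideal.Quotient.lift 𝔭 (eval y) hy
  have hχ : ∀ f, χ (mk f) = eval y f := fun f => Ideal.Quotient.lift_mk _ _ _
  have hχc : χ.comp c = RingHom.id ℝ := by
    ext a; simp only [RingHom.comp_apply, c, hχ, eval_C, RingHom.id_apply]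
  have hev : ∀ (x : Fin n → ℝ) (f : MvPolynomial (Fin n) ℝ), eval₂ χ x (map c f) = eval x f := by
    intro x f
    rw [eval₂_map, hχc]; rfl
  have hP : ∀ x i, eval₂ χ x (P i) = eval x (p i) - y i * eval x (q i) := by
    intro x i
    simp only [P, eval₂_sub, eval₂_mul, hev, eval₂_C, hχ, eval_X]
  have hE : ∀ x, F x = y → eval₂ χ x E ≠ 0 := by
    intro x hx
    have e := RingHom.map_det (eval₂Hom χ x) (Matrix.of fun i j => pderiv j (P i))
    have e2 : (eval₂Hom χ x).mapMatrix (Matrix.of fun i j => pderiv j (P i)) =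
        Matrix.of fun i j => eval x (pderiv j (p i)) - F x i * eval x (pderiv j (q i)) := by
      ext i j
      simp only [RingHom.mapMatrix_apply, Matrix.map_apply, Matrix.of_apply, P, map_sub,
        Derivation.leibniz, pderiv_C, pderiv_map, smul_eq_mul, mul_zero, add_zero, map_mul,
        coe_eval₂Hom, hev, eval₂_C, hχ, eval_X, hx, eval₂_sub, eval₂_mul]
    rw [e2] at e
    change eval₂Hom χ x E ≠ 0
    rw [e]
    exact graph_det hq hF hjac x
  have hset : {x : Fin n → ℝ | (∀ f ∈ Ideal.span (Set.range P), eval₂ χ x f = 0) ∧ eval₂ χ x E ≠ 0} =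
      F ⁻¹' {y} := by
    ext x
    constructor
    · rintro ⟨h1, -⟩
      ext i
      have := h1 _ (Ideal.subset_span ⟨i, rfl⟩)
      rw [hP, graph_iff hq hF] at this
      exact this
    · intro hx
      have hx' : F x = y := hx
      refine ⟨fun f hf => ?_, hE x hx'⟩
      have : Ideal.span (Set.range P) ≤ RingHom.ker (eval₂Hom χ x) := by
        rw [Ideal.span_le]
        rintro _ ⟨i, rfl⟩
        change eval₂ χ x (P i) = 0
        rw [hP, graph_iff hq hF, hx']
      exact this hf
  have := (h χ (by change χ (mk Q) ≠ 0; rw [hχ]; exact hyQ)).2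
  rwa [hset] at this
end
end

section
open Topology Filter MvPolynomial

lemma chart_lemma {n m : ℕ} (A O : Set (Fin n → ℝ)) (hO : IsOpen O) (a : Fin n → ℝ) (haO : a ∈ O)
    (f : Fin m → MvPolynomial (Fin n) ℝ) (hf : ∀ y ∈ A ∩ O, ∀ i, eval y (f i) = 0)
    (hfa : ∀ i, eval a (f i) = 0) (ν : Matrix (Fin n) (Fin m) ℝ)
    (hν : ∀ i j, ∑ k, eval a (pderiv k (f i)) * ν k j = if i = j then 1 else 0) :
    ∃ ε : ℝ, 0 < ε ∧ ∃ η : ℝ, 0 < η ∧ ∀ (e : Fin m → ℝ) (r : Fin n → ℝ), ‖e‖ ≤ 1 → e ≠ 0 → ‖r‖ ≤ η * ‖e‖ →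
      a + (ε • ν).mulVec e + r ∉ A := by
  classical
  let τ : (Fin n → ℝ) → (Fin m → ℝ) := fun y i => eval y (f i)
  let τ' : (Fin n → ℝ) →L[ℝ] (Fin m → ℝ) := ContinuousLinearMap.pi fun i =>
    ∑ j, eval a (pderiv j (f i)) • (ContinuousLinearMap.proj j : (Fin n → ℝ) →L[ℝ] ℝ)
  have hτ : HasFDerivAt τ τ' a := hasFDerivAt_pi.2 fun i => eval_hasFDeriv (f i) a
  let N : (Fin m → ℝ) →L[ℝ] (Fin n → ℝ) := LinearMap.toContinuousLinearMap (Matrix.mulVecLin ν)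
  have hN : ∀ e, N e = ν.mulVec e := fun e => rfl
  have hτN : ∀ e, τ' (N e) = e := by
    intro e
    ext i
    simp only [τ', ContinuousLinearMap.pi_apply, ContinuousLinearMap.sum_apply,
      ContinuousLinearMap.smul_apply, ContinuousLinearMap.proj_apply, smul_eq_mul, hN,
      Matrix.mulVec, dotProduct]
    simp only [Finset.mul_sum, ← mul_assoc]
    rw [Finset.sum_comm]
    simp only [← Finset.sum_mul, hν]
    simp
  set c : ℝ := 1 / (4 * (‖N‖ + 1)) with hc
  have hNn := norm_nonneg N
  have hTn := norm_nonneg τ'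
  have hc0 : 0 < c := by positivity
  have hlo := hτ.isLittleO.bound hc0
  obtain ⟨ρ, hρ, hball⟩ := Metric.eventually_nhds_iff.1 (hlo.and (hO.mem_nhds haO))
  refine ⟨ρ / (2 * (‖N‖ + 1)), by positivity, ?_⟩
  set ε := ρ / (2 * (‖N‖ + 1)) with hε
  have hε0 : 0 < ε := by positivity
  have hεN : ε * ‖N‖ < ρ / 2 := by
    rw [hε, div_mul_eq_mul_div, div_lt_div_iff₀ (by positivity) (by positivity)]; nlinarith
  have hcN : c * ‖N‖ ≤ 1 / 4 := by
    rw [hc, div_mul_eq_mul_div, div_le_div_iff₀ (by positivity) (by positivity)]; nlinarith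
  refine ⟨min (ρ / 2) (ε / (4 * (‖τ'‖ + c))), by positivity, ?_⟩
  set η := min (ρ / 2) (ε / (4 * (‖τ'‖ + c))) with hη
  have hη1 : η ≤ ρ / 2 := min_le_left _ _
  have hη2 : η * (‖τ'‖ + c) ≤ ε / 4 := by
    have : η ≤ ε / (4 * (‖τ'‖ + c)) := min_le_right _ _
    rw [le_div_iff₀ (by positivity)] at this
    linarith
  intro e r he he0 hr hA
  have he1 : 0 < ‖e‖ := norm_pos_iff.2 he0
  have hy : a + (ε • ν).mulVec e + r = a + (ε • N e + r) := by
    rw [Matrix.smul_mulVec, hN, add_assoc]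
  rw [hy] at hA
  have hNe : ‖N e‖ ≤ ‖N‖ * ‖e‖ := N.le_opNorm e
  have hb : ‖ε • N e + r‖ ≤ ε * ‖N‖ * ‖e‖ + η * ‖e‖ := by
    refine (norm_add_le _ _).trans (add_le_add ?_ hr)
    rw [norm_smul, Real.norm_of_nonneg hε0.le, mul_assoc]
    exact mul_le_mul_of_nonneg_left hNe hε0.le
  have hd : dist (a + (ε • N e + r)) a < ρ := by
    rw [dist_eq_norm, add_sub_cancel_left]
    nlinarith
  obtain ⟨h1, h2⟩ := hball hd
  have hz : τ (a + (ε • N e + r)) = 0 := funext fun i => hf _ ⟨hA, h2⟩ i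
  have hza : τ a = 0 := funext hfa
  rw [hz, hza, add_sub_cancel_left, map_add, map_smul, hτN, sub_zero, zero_sub, norm_neg] at h1
  have h3 : ε * ‖e‖ ≤ ‖ε • e + τ' r‖ + ‖τ' r‖ := by
    have := norm_sub_le (ε • e + τ' r) (τ' r)
    rw [add_sub_cancel_right, norm_smul, Real.norm_of_nonneg hε0.le] at this
    exact this
  have h4 : ‖τ' r‖ ≤ ‖τ'‖ * (η * ‖e‖) := (τ'.le_opNorm r).trans (mul_le_mul_of_nonneg_left hr hTn)
  have h5 : c * ‖ε • N e + r‖ ≤ c * (ε * ‖N‖ * ‖e‖ + η * ‖e‖) := mul_le_mul_of_nonneg_left hb hc0.le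
  have h6 : ε * ‖e‖ ≤ (c * ‖N‖) * (ε * ‖e‖) + (η * (‖τ'‖ + c)) * ‖e‖ := by nlinarith
  have h7 : (c * ‖N‖) * (ε * ‖e‖) ≤ 1/4 * (ε * ‖e‖) := mul_le_mul_of_nonneg_right hcN (by positivity)
  have h8 : (η * (‖τ'‖ + c)) * ‖e‖ ≤ ε/4 * ‖e‖ := mul_le_mul_of_nonneg_right hη2 he1.le
  have h9 : 0 < ε * ‖e‖ := by positivity
  linarith
end

section
open Topology Filter MvPolynomial

abbrev Sg (n m : ℕ) : Type := Fin n ⊕ (Fin (m+1) ⊕ Fin 2)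

section
variable {n m : ℕ}

def vX (x : Sg n m → ℝ) : Fin n → ℝ := fun i => x (Sum.inl i)
def vE (x : Sg n m → ℝ) : Fin (m+1) → ℝ := fun j => x (Sum.inr (Sum.inl j))
def vU (x : Sg n m → ℝ) : ℝ := x (Sum.inr (Sum.inr 0))
def vV (x : Sg n m → ℝ) : ℝ := x (Sum.inr (Sum.inr 1))
noncomputable def ell (x : Sg n m → ℝ) : Fin (m+1) → ℝ :=
  fun j => ((1 - vU x) * (Pi.single 0 1 : Fin (m+1) → ℝ) j + (1 + vU x) * vE x j) / 2

lemma vX_cont : Continuous (vX : (Sg n m → ℝ) → _) := by unfold vX; fun_prop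
lemma vE_cont : Continuous (vE : (Sg n m → ℝ) → _) := by unfold vE; fun_prop
lemma vU_cont : Continuous (vU : (Sg n m → ℝ) → _) := by unfold vU; fun_prop
lemma vV_cont : Continuous (vV : (Sg n m → ℝ) → _) := by unfold vV; fun_prop
lemma ell_cont : Continuous (ell : (Sg n m → ℝ) → _) := by
  unfold ell vE vU; fun_prop

lemma ell_sum (x : Sg n m → ℝ) (he : ∑ j, vE x j ^ 2 = 1) :
    ∑ j, ell x j ^ 2 = (1 + vU x ^ 2) / 2 + (1 - vU x ^ 2) / 2 * vE x 0 := by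
  rw [Fin.sum_univ_succ] at he ⊢
  have h1 : ∀ j : Fin m, ell x j.succ ^ 2 = ((1 + vU x)/2)^2 * vE x j.succ ^ 2 := by
    intro j
    simp only [ell, Pi.single_apply, Fin.succ_ne_zero, if_false]
    ring
  simp only [h1, ← Finset.mul_sum]
  have h2 : ∑ j : Fin m, vE x j.succ ^ 2 = 1 - vE x 0 ^ 2 := by linarith
  rw [h2]
  simp only [ell, Pi.single_eq_same]
  ring

lemma ell_facts (x : Sg n m → ℝ) (he : ∑ j, vE x j ^ 2 = 1) (hu : vU x ^ 2 + vV x ^ 2 = 1) :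
    vU x ^ 2 ≤ ∑ j, ell x j ^ 2 ∧ ‖ell x‖ ≤ 1 ∧ ∑ j, ell x j ^ 2 ≤ (m + 1) * ‖ell x‖ := by
  have hs := ell_sum x he
  have h0 : vE x 0 ^ 2 ≤ 1 := by
    rw [← he]
    exact Finset.single_le_sum (f := fun j => vE x j ^ 2) (fun j _ => sq_nonneg _) (Finset.mem_univ 0)
  have h1 : -1 ≤ vE x 0 := by nlinarith
  have h2 : vE x 0 ≤ 1 := by nlinarith
  have h3 : vU x ^ 2 ≤ 1 := by nlinarith [sq_nonneg (vV x)]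
  have h4 : ∑ j, ell x j ^ 2 ≤ 1 := by rw [hs]; nlinarith
  have hn : ‖ell x‖ ≤ 1 := by
    rw [pi_norm_le_iff_of_nonneg zero_le_one]
    intro j
    have : ell x j ^ 2 ≤ ∑ j, ell x j ^ 2 :=
      Finset.single_le_sum (f := fun j => ell x j ^ 2) (fun j _ => sq_nonneg _) (Finset.mem_univ j)
    rw [Real.norm_eq_abs, abs_le]
    constructor <;> nlinarith
  refine ⟨by rw [hs]; nlinarith, hn, ?_⟩
  have : ∀ j ∈ Finset.univ, ell x j ^ 2 ≤ ‖ell x‖ := by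
    intro j _
    have h5 : |ell x j| ≤ ‖ell x‖ := norm_le_pi_norm (ell x) j
    rw [← sq_abs]
    nlinarith [abs_nonneg (ell x j)]
  refine (Finset.sum_le_card_nsmul _ _ _ this).trans ?_
  simp

lemma ell_zero (x : Sg n m → ℝ) (he : ∑ j, vE x j ^ 2 = 1) (hu : vU x ^ 2 + vV x ^ 2 = 1)
    (h : ell x = 0) : vE x = - Pi.single 0 1 ∧ vU x = 0 := by
  have h1 := (ell_facts x he hu).1
  simp only [h, Pi.zero_apply, ne_eq, OfNat.ofNat_ne_zero, not_false_eq_true, zero_pow,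
    Finset.sum_const_zero] at h1
  have hU : vU x = 0 := by nlinarith
  refine ⟨?_, hU⟩
  ext j
  have := congrFun h j
  simp only [ell, hU, Pi.zero_apply] at this
  simp only [Pi.neg_apply]
  linarith

def Scfg (F : (Fin n → ℝ) → (Fin n → ℝ)) (a : Fin n → ℝ) (L : Matrix (Fin n) (Fin (m+1)) ℝ) :
    Set (Sg n m → ℝ) :=
  {x | F (vX x) = a + L.mulVec (vE x) ∧ ∑ j, vE x j ^ 2 = 1 ∧ vU x ^ 2 + vV x ^ 2 = 1}

lemma kap_cont (a : Fin n → ℝ) (L : Matrix (Fin n) (Fin (m+1)) ℝ) :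
    Continuous fun e => a + L.mulVec e :=
  continuous_const.add (Continuous.matrix_mulVec continuous_const continuous_id)

lemma approx_map (F : (Fin n → ℝ) → (Fin n → ℝ)) (hF : Continuous F) (A : Set (Fin n → ℝ))
    (hA : IsClosed A) (hU : ∀ x, F x ∉ A) (a : Fin n → ℝ) (L : Matrix (Fin n) (Fin (m+1)) ℝ)
    (η : ℝ) (hη : 0 < η) (hch : ∀ (e : Fin (m+1) → ℝ) (r : Fin n → ℝ), ‖e‖ ≤ 1 → e ≠ 0 →
      ‖r‖ ≤ η * ‖e‖ → a + L.mulVec e + r ∉ A)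
    (hS : IsCompact (Scfg F a L)) (x1 : Fin n → ℝ) (hx1 : F x1 = a + L.mulVec (Pi.single 0 1)) :
    ∃ q : Fin n → MvPolynomial (Sg n m) ℝ, ∀ x ∈ Scfg F a L,
      (a + L.mulVec (ell x) + fun k => (1 + vV x) ^ 2 * eval x (q k)) ∈ A →
        vE x = - Pi.single 0 1 ∧ vU x = 0 ∧ vV x = -1 := by
  classical
  let S := Scfg F a L
  let path : (Sg n m → ℝ) → (Fin n → ℝ) := fun x => x1 + ((1 + vU x) / 2) • (vX x - x1)
  have hpath : Continuous path :=
    continuous_const.add (((continuous_const.add vU_cont).div_const 2).smul (vX_cont.sub continuous_const))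
  let G : (Sg n m → ℝ) → (Fin n → ℝ) := fun x => F (path x)
  have hG : Continuous G := hF.comp hpath
  have hT : IsCompact (G '' S) := hS.image hG
  obtain ⟨δ1, hδ1, hthick⟩ := hT.exists_thickening_subset_open hA.isOpen_compl
    (by rintro _ ⟨x, -, rfl⟩; exact hU _)
  let Kp : (Sg n m → ℝ) → (Fin n → ℝ) := fun x => a + L.mulVec (ell x)
  have hKp : Continuous Kp := (kap_cont a L).comp ell_cont
  let Sp := S ∩ {x | 0 ≤ vV x}
  let Sm := S ∩ {x | vV x ≤ 0}
  have hSp : IsClosed Sp := hS.isClosed.inter (isClosed_le continuous_const vV_cont)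
  have hSm : IsClosed Sm := hS.isClosed.inter (isClosed_le vV_cont continuous_const)
  let q0 : Fin n → (Sg n m → ℝ) → ℝ := fun k x => if 0 ≤ vV x then (G x k - Kp x k) / (1 + vV x) ^ 2 else 0
  have hagree : ∀ x ∈ S, vV x = 0 → G x = Kp x := by
    intro x hx hv
    obtain ⟨h1, h2, h3⟩ := hx
    rw [hv] at h3
    have hu : vU x = 1 ∨ vU x = -1 := by
      have : (vU x - 1) * (vU x + 1) = 0 := by nlinarith
      rcases mul_eq_zero.1 this with h | h
      · left; linarith
      · right; linarith
    rcases hu with hu | hu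
    · have e1 : ell x = vE x := by ext j; simp only [ell, hu]; ring
      have e2 : path x = vX x := by
        simp only [path, hu]; norm_num
      simp only [G, Kp, e1, e2, h1]
    · have e1 : ell x = Pi.single 0 1 := by ext j; simp only [ell, hu]; ring
      have e2 : path x = x1 := by
        simp only [path, hu]; norm_num
      simp only [G, Kp, e1, e2, hx1]
  have hq0m : ∀ k, ∀ x ∈ Sm, q0 k x = 0 := by
    intro k x hx
    by_cases h : 0 ≤ vV x
    · have hv : vV x = 0 := le_antisymm hx.2 h
      simp only [q0, hagree x hx.1 hv, sub_self, zero_div, ite_self]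
    · simp only [q0, h, if_false]
  have hq0 : ∀ k, ContinuousOn (q0 k) S := by
    intro k
    have hun : S = Sp ∪ Sm := by
      ext x
      constructor
      · intro hx
        rcases le_total 0 (vV x) with h | h
        · exact Or.inl ⟨hx, h⟩
        · exact Or.inr ⟨hx, h⟩
      · rintro (h | h) <;> exact h.1
    rw [hun]
    refine ContinuousOn.union_of_isClosed ?_ ?_ hSp hSm
    · have : ContinuousOn (fun x => (G x k - Kp x k) / (1 + vV x) ^ 2) Sp := by
        refine ContinuousOn.div ?_ ?_ ?_
        · exact (((continuous_apply k).comp hG).sub ((continuous_apply k).comp hKp)).continuousOn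
        · exact ((continuous_const.add vV_cont).pow 2).continuousOn
        · intro x hx
          have : (0:ℝ) ≤ vV x := hx.2
          positivity
      refine this.congr fun x hx => ?_
      have : (0:ℝ) ≤ vV x := hx.2
      simp only [q0, this, if_true]
    · exact (continuousOn_const (c := (0:ℝ))).congr fun x hx => hq0m k x hx
  set δ := min (δ1 / 8) (η / (m + 1)) with hδ
  have hδ0 : 0 < δ := by positivity
  choose q hq using fun k => stone_w S hS (q0 k) (hq0 k) δ hδ0
  refine ⟨q, fun x hx hmem => ?_⟩
  obtain ⟨h1, h2, h3⟩ := id hx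
  obtain ⟨f1, f2, f3⟩ := ell_facts x h2 h3
  have hv2 : vV x ^ 2 ≤ 1 := by nlinarith [sq_nonneg (vU x)]
  have hv1 : vV x ≤ 1 := by nlinarith
  have hvm : -1 ≤ vV x := by nlinarith
  rcases le_or_gt (vV x) 0 with hv | hv
  · have hl : ell x = 0 := by
      by_contra hne
      refine hch (ell x) _ f2 hne ?_ hmem
      rw [pi_norm_le_iff_of_nonneg (by positivity)]
      intro k
      have hqk := hq k x hx
      rw [hq0m k x ⟨hx, hv⟩, sub_zero] at hqk
      rw [Real.norm_eq_abs, abs_mul, abs_of_nonneg (sq_nonneg (1 + vV x))]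
      have hw : (1 + vV x) ^ 2 ≤ (m + 1) * ‖ell x‖ := by
        refine le_trans ?_ (f1.trans f3)
        nlinarith
      have hd2 : δ * (m + 1) ≤ η := by
        have : δ ≤ η / (m + 1) := min_le_right _ _
        rwa [le_div_iff₀ (by positivity)] at this
      calc (1 + vV x) ^ 2 * |eval x (q k)| ≤ ((m + 1) * ‖ell x‖) * δ :=
            mul_le_mul hw hqk.le (abs_nonneg _) (by positivity)
        _ = (δ * (m + 1)) * ‖ell x‖ := by ring
        _ ≤ η * ‖ell x‖ := mul_le_mul_of_nonneg_right hd2 (norm_nonneg _)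
    obtain ⟨g1, g2⟩ := ell_zero x h2 h3 hl
    refine ⟨g1, g2, ?_⟩
    rw [g2] at h3
    have : (vV x - 1) * (vV x + 1) = 0 := by nlinarith
    rcases mul_eq_zero.1 this with h | h <;> linarith
  · exfalso
    refine hthick ?_ hmem
    rw [Metric.mem_thickening_iff]
    refine ⟨G x, ⟨x, hx, rfl⟩, ?_⟩
    rw [dist_pi_lt_iff hδ1]
    intro k
    have hqk := hq k x hx
    simp only [q0, hv.le, if_true] at hqk
    have hw0 : (0:ℝ) < (1 + vV x) ^ 2 := by positivity
    have hw4 : (1 + vV x) ^ 2 ≤ 4 := by nlinarith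
    have e : (a + L.mulVec (ell x) + (fun k => (1 + vV x) ^ 2 * eval x (q k) : Fin n → ℝ) : Fin n → ℝ) k - G x k =
        (1 + vV x) ^ 2 * (eval x (q k) - (G x k - Kp x k) / (1 + vV x) ^ 2) := by
      rw [mul_sub, mul_div_cancel₀ _ hw0.ne']
      simp only [Kp, Pi.add_apply]
      ring
    rw [Real.dist_eq, e, abs_mul, abs_of_pos hw0]
    have hd1 : δ ≤ δ1 / 8 := min_le_left _ _
    calc (1 + vV x) ^ 2 * |eval x (q k) - (G x k - Kp x k) / (1 + vV x) ^ 2| ≤ 4 * δ :=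
          mul_le_mul hw4 hqk.le (abs_nonneg _) (by norm_num)
      _ < δ1 := by linarith

lemma Scfg_compact (F : (Fin n → ℝ) → (Fin n → ℝ)) (hF : Continuous F)
    (hP : ∀ y ∈ Set.range F, ∃ K ∈ 𝓝 y, IsCompact K ∧ IsCompact (F ⁻¹' K))
    (a : Fin n → ℝ) (L : Matrix (Fin n) (Fin (m+1)) ℝ)
    (hL : ∀ e : Fin (m+1) → ℝ, ∑ j, e j ^ 2 = 1 → a + L.mulVec e ∈ Set.range F) :
    IsCompact (Scfg F a L) := by
  classical
  let Sph : Set (Fin (m+1) → ℝ) := {e | ∑ j, e j ^ 2 = 1}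
  have hSphb : ∀ e ∈ Sph, ∀ j, |e j| ≤ 1 := by
    intro e he j
    have h1 : e j ^ 2 ≤ ∑ j, e j ^ 2 :=
      Finset.single_le_sum (f := fun j => e j ^ 2) (fun j _ => sq_nonneg (e j)) (Finset.mem_univ j)
    have he' : ∑ j, e j ^ 2 = 1 := he
    rw [abs_le]; constructor <;> nlinarith
  have hSph : IsCompact Sph := by
    refine IsCompact.of_isClosed_subset (isCompact_Icc (a := fun _ => (-1:ℝ)) (b := fun _ => (1:ℝ))) ?_ ?_
    · exact isClosed_eq (by fun_prop) continuous_const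
    · intro e he
      exact ⟨fun j => (abs_le.1 (hSphb e he j)).1, fun j => (abs_le.1 (hSphb e he j)).2⟩
  let C := (fun e => a + L.mulVec e) '' Sph
  have hC : IsCompact C := hSph.image (kap_cont a L)
  have hFC : IsCompact (F ⁻¹' C) := by
    choose! K hK1 hK2 hK3 using hP
    obtain ⟨t, ht, hCt⟩ := hC.elim_nhds_subcover K (by rintro _ ⟨e, he, rfl⟩; exact hK1 _ (hL e he))
    refine IsCompact.of_isClosed_subset (t.isCompact_biUnion fun y hy => hK3 y ?_)
      (hC.isClosed.preimage hF) ?_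
    · obtain ⟨e, he, rfl⟩ := ht y hy
      exact hL e he
    · intro x hx
      obtain ⟨y, hy, hxy⟩ := Set.mem_iUnion₂.1 (hCt hx)
      exact Set.mem_biUnion hy hxy
  obtain ⟨B, hB⟩ := hFC.isBounded.exists_norm_le
  refine IsCompact.of_isClosed_subset (isCompact_Icc (a := fun _ => -(max B 1)) (b := fun _ => max B 1)) ?_ ?_
  · refine (isClosed_eq (hF.comp vX_cont) ((kap_cont a L).comp vE_cont)).inter ((isClosed_eq ?_ continuous_const).inter
      (isClosed_eq ((vU_cont.pow 2).add (vV_cont.pow 2)) continuous_const))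
    unfold vE; fun_prop
  · rintro x ⟨h1, h2, h3⟩
    have hall : ∀ s, |x s| ≤ max B 1 := by
      rintro (i | j | k)
      · refine le_trans (le_trans (norm_le_pi_norm (vX x) i) (hB _ ?_)) (le_max_left _ _)
        exact ⟨vE x, h2, h1.symm⟩
      · exact (hSphb (vE x) h2 j).trans (le_max_right _ _)
      · refine le_trans ?_ (le_max_right _ _)
        fin_cases k
        · change |vU x| ≤ 1
          rw [abs_le]; constructor <;> nlinarith [sq_nonneg (vV x)]
        · change |vV x| ≤ 1
          rw [abs_le]; constructor <;> nlinarith [sq_nonneg (vU x)]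
    exact ⟨fun s => (abs_le.1 (hall s)).1, fun s => (abs_le.1 (hall s)).2⟩
end
end

section
open Topology Filter MvPolynomial

section
variable {σ α β : Type} [Fintype σ] [DecidableEq σ] {n : ℕ}

lemma fev_sub (H : Fin n → MvPolynomial σ (Polynomial ℝ)) (f : MvPolynomial (Fin n) ℝ) (s : ℝ) (x : σ → ℝ) :
    fev s x (eval₂ ((C : Polynomial ℝ →+* MvPolynomial σ (Polynomial ℝ)).comp Polynomial.C) H f) =
      eval (fun k => fev s x (H k)) f := by
  have h := eval₂_comp_left (fev s x) ((C : Polynomial ℝ →+* MvPolynomial σ (Polynomial ℝ)).comp Polynomial.C) H f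
  rw [h]
  have : (fev s x).comp ((C : Polynomial ℝ →+* MvPolynomial σ (Polynomial ℝ)).comp Polynomial.C) = RingHom.id ℝ := by
    ext r; simp [fev_C]
  rw [this]; rfl

lemma abs_parity (eqv : σ → α ⊕ β) (heqv : Function.Surjective eqv)
    (g : α → MvPolynomial σ ℝ) (h1 : Fin n → MvPolynomial σ ℝ) (f : β → MvPolynomial (Fin n) ℝ)
    (𝔭 : Ideal (MvPolynomial (Fin n) ℝ)) (hf : ∀ i, f i ∈ 𝔭) (Q : MvPolynomial (Fin n) ℝ)
    (A : Set (Fin n → ℝ)) (hA : IsClosed A)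
    (hVA : ∀ y, (∀ e ∈ 𝔭, eval y e = 0) → eval y Q ≠ 0 → y ∈ A)
    (u0 : Fin n → ℝ) (hu0 : u0 ∉ A) (a : Fin n → ℝ) (ha : ∀ e ∈ 𝔭, eval a e = 0) (hQa : eval a Q ≠ 0)
    (gg : MvPolynomial (Fin n) ℝ) (hgga : eval a gg ≠ 0)
    (hgg : ∀ e ∈ 𝔭, gg * e ∈ Ideal.span (Set.range f))
    (hS : IsCompact {x : σ → ℝ | ∀ i, eval x (g i) = 0}) (R : Finset (σ → ℝ))
    (hR : ∀ x, (∀ i, eval x (g i) = 0) → (fun k => eval x (h1 k)) ∈ A → x ∈ R)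
    (hR2 : ∀ x ∈ R, (∀ i, eval x (g i) = 0) ∧ (fun k => eval x (h1 k)) = a)
    (hdet : ∀ x ∈ R, ∀ v : σ → ℝ, (∀ i, ∑ j, eval x (pderiv j (g i)) * v j = 0) →
      (∀ b, ∑ k, eval a (pderiv k (f b)) * (∑ j, eval x (pderiv j (h1 k)) * v j) = 0) → v = 0) :
    R.card ≡ 0 [MOD 2] := by
  classical
  let H : Fin n → MvPolynomial σ (Polynomial ℝ) := fun k =>
    C Polynomial.X * map Polynomial.C (h1 k) + C (1 - Polynomial.X) * C (Polynomial.C (u0 k))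
  have hH : ∀ s x k, fev s x (H k) = s * eval x (h1 k) + (1 - s) * u0 k := by
    intro s x k
    simp only [H, map_add, map_mul, fev_C, fev_map, Polynomial.eval_X, Polynomial.eval_sub,
      Polynomial.eval_one, Polynomial.eval_C]
  let Hv : ℝ × (σ → ℝ) → (Fin n → ℝ) := fun w k => fev w.1 w.2 (H k)
  have hHv : Continuous Hv := continuous_pi fun k => fev_cont (H k)
  have hH1 : ∀ x, Hv (1, x) = fun k => eval x (h1 k) := by
    intro x; ext k; simp [Hv, hH]
  have hH0 : ∀ x, Hv (0, x) = u0 := by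
    intro x; ext k; simp [Hv, hH]
  let sub : MvPolynomial (Fin n) ℝ → MvPolynomial σ (Polynomial ℝ) :=
    eval₂ ((C : Polynomial ℝ →+* MvPolynomial σ (Polynomial ℝ)).comp Polynomial.C) H
  have hsub : ∀ s x e, fev s x (sub e) = eval (Hv (s, x)) e := fun s x e => fev_sub H e s x
  let P : σ → MvPolynomial σ (Polynomial ℝ) := fun s =>
    Sum.elim (fun i => map Polynomial.C (g i)) (fun b => sub (f b)) (eqv s)
  let P' : α ⊕ 𝔭 → MvPolynomial σ (Polynomial ℝ) :=
    Sum.elim (fun i => map Polynomial.C (g i)) (fun e => sub e.1)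
  let I := Ideal.span (Set.range P')
  have hP : ∀ i, P i ∈ I := by
    intro i
    rcases h : eqv i with k | b
    · simp only [P, h, Sum.elim_inl]
      exact Ideal.subset_span ⟨Sum.inl k, rfl⟩
    · simp only [P, h, Sum.elim_inr]
      exact Ideal.subset_span ⟨Sum.inr ⟨f b, hf b⟩, rfl⟩
  let E := (Matrix.of fun i j => pderiv j (P i)).det * sub Q
  obtain ⟨D, hD⟩ := fam_parity I P hP E (Dvd.intro _ rfl)
  have hPz : ∀ s x, (∀ i, fev s x (P i) = 0) ↔ (∀ i, eval x (g i) = 0) ∧ ∀ b, eval (Hv (s,x)) (f b) = 0 := by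
    intro s x
    constructor
    · intro h
      refine ⟨fun i => ?_, fun b => ?_⟩
      · obtain ⟨t, ht⟩ := heqv (Sum.inl i)
        have := h t
        simpa only [P, ht, Sum.elim_inl, fev_map] using this
      · obtain ⟨t, ht⟩ := heqv (Sum.inr b)
        have := h t
        simpa only [P, ht, Sum.elim_inr, hsub] using this
    · rintro ⟨h, h'⟩ i
      rcases hi : eqv i with k | b
      · simp only [P, hi, Sum.elim_inl, fev_map, h]
      · simp only [P, hi, Sum.elim_inr, hsub, h']
  have hZ : ∀ s x, x ∈ famZ I E s ↔ ((∀ i, eval x (g i) = 0) ∧ ∀ e ∈ 𝔭, eval (Hv (s,x)) e = 0) ∧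
      (Matrix.of fun i j => fev s x (pderiv j (P i))).det ≠ 0 ∧ eval (Hv (s,x)) Q ≠ 0 := by
    intro s x
    rw [famZ_span]
    refine and_congr ?_ ?_
    · constructor
      · intro h
        refine ⟨fun i => ?_, fun e he => ?_⟩
        · simpa only [P', Sum.elim_inl, fev_map] using h (Sum.inl i)
        · simpa only [P', Sum.elim_inr, hsub] using h (Sum.inr ⟨e, he⟩)
      · rintro ⟨h, h'⟩ (i | e)
        · simp only [P', Sum.elim_inl, fev_map, h]
        · simp only [P', Sum.elim_inr, hsub, h' e.1 e.2]
    · simp only [E, map_mul, hsub, ne_eq, mul_eq_zero, not_or]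
      rw [RingHom.map_det]
      rfl
  have hZA : ∀ s x, x ∈ famZ I E s → (∀ i, eval x (g i) = 0) ∧ Hv (s, x) ∈ A := by
    intro s x hx
    obtain ⟨⟨h1, h2⟩, -, h3⟩ := (hZ s x).1 hx
    exact ⟨h1, hVA _ h2 h3⟩
  -- tube
  have tube : ∀ (s0 : ℝ) (O : Set (σ → ℝ)), IsOpen O →
      (∀ x, (∀ i, eval x (g i) = 0) → x ∉ O → Hv (s0, x) ∉ A) → ∀ᶠ s in 𝓝 s0, famZ I E s ⊆ O := by
    intro s0 O hO h
    have hK : IsCompact ({x : σ → ℝ | ∀ i, eval x (g i) = 0} \ O) := hS.diff hO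
    have hop : IsOpen (Hv ⁻¹' Aᶜ) := hA.isOpen_compl.preimage hHv
    have : ∀ᶠ s in 𝓝 s0, ∀ x ∈ ({x : σ → ℝ | ∀ i, eval x (g i) = 0} \ O), Hv (s, x) ∉ A := by
      refine hK.eventually_forall_of_forall_eventually ?_
      intro x hx
      exact hop.mem_nhds (h x hx.1 hx.2)
    filter_upwards [this] with s hs x hx
    by_contra hxO
    obtain ⟨h1, h2⟩ := hZA s x hx
    exact hs x ⟨h1, hxO⟩ h2
  have hev0 : ∀ᶠ s in 𝓝 (0:ℝ), famZ I E s ⊆ ∅ :=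
    tube 0 ∅ isOpen_empty fun x _ _ => by rw [hH0]; exact hu0
  have hD0 : 0 ≡ D [MOD 2] := by
    obtain ⟨s, hs1, hs2⟩ := ((hD 0).and (hev0.filter_mono nhdsWithin_le_nhds)).exists
    rw [Set.subset_empty_iff.1 hs2, Set.ncard_empty] at hs1
    exact hs1
  have hdet' : ∀ x ∈ R, (Matrix.of fun i j => fev 1 x (pderiv j (P i))).det ≠ 0 := by
    intro x hx h0
    obtain ⟨v, hv, hMv⟩ := Matrix.exists_mulVec_eq_zero_iff.2 h0
    apply hv
    apply hdet x hx v
    · intro i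
      obtain ⟨t, ht⟩ := heqv (Sum.inl i)
      have := congrFun hMv t
      simpa only [Matrix.mulVec, dotProduct, Matrix.of_apply, P, ht, Sum.elim_inl, pderiv_map, fev_map, Pi.zero_apply] using this
    · intro b
      obtain ⟨t, ht⟩ := heqv (Sum.inr b)
      have h2 := congrFun hMv t
      simp only [Matrix.mulVec, dotProduct, Matrix.of_apply, P, ht, Sum.elim_inr, Pi.zero_apply] at h2
      have d1 := fev_hasFDeriv (sub (f b)) 1 x
      have d2 : HasFDerivAt (fun x k => eval x (h1 k)) (ContinuousLinearMap.pi fun k =>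
          ∑ j, eval x (pderiv j (h1 k)) • (ContinuousLinearMap.proj j : (σ → ℝ) →L[ℝ] ℝ)) x :=
        hasFDerivAt_pi.2 fun k => eval_hasFDeriv (h1 k) x
      have d3 := (eval_hasFDeriv (f b) (fun k => eval x (h1 k))).comp x d2
      have e1 : (fun x => fev 1 x (sub (f b))) = (fun y => eval y (f b)) ∘ (fun x k => eval x (h1 k)) := by
        funext x
        rw [hsub, hH1]; rfl
      rw [e1] at d1
      have e2 := congrArg (fun T => T v) (d1.unique d3)
      rw [(hR2 x hx).2] at e2
      simp only [ContinuousLinearMap.sum_apply, ContinuousLinearMap.smul_apply,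
        ContinuousLinearMap.proj_apply, smul_eq_mul, ContinuousLinearMap.comp_apply,
        ContinuousLinearMap.pi_apply] at e2
      rw [← e2, h2]
  have hHa : ∀ x ∈ R, Hv (1, x) = a := fun x hx => by rw [hH1, (hR2 x hx).2]
  have hcount := fam_count I P hP E 1 R
    (fun x hx => (hPz 1 x).2 ⟨(hR2 x hx).1, fun b => by rw [hHa x hx]; exact ha _ (hf b)⟩)
    hdet' ?_ ?_
  · obtain ⟨s, hs1, hs2⟩ := ((hD 1).and (hcount.filter_mono nhdsWithin_le_nhds)).exists
    rw [hs2] at hs1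
    exact hs1.trans hD0.symm
  · intro x hx
    have c1 : ∀ᶠ w in 𝓝 ((1:ℝ), x), eval (Hv w) Q ≠ 0 := by
      have : ContinuousAt (fun w => eval (Hv w) Q) (1, x) := ((continuous_eval Q).comp hHv).continuousAt
      exact this.eventually_ne (by rw [hHa x hx]; exact hQa)
    have c2 : ∀ᶠ w in 𝓝 ((1:ℝ), x), eval (Hv w) gg ≠ 0 := by
      have : ContinuousAt (fun w => eval (Hv w) gg) (1, x) := ((continuous_eval gg).comp hHv).continuousAt
      exact this.eventually_ne (by rw [hHa x hx]; exact hgga)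
    have c3 : ∀ᶠ w in 𝓝 ((1:ℝ), x), (Matrix.of fun i j => fev w.1 w.2 (pderiv j (P i))).det ≠ 0 := by
      have : Continuous (fun w : ℝ × (σ → ℝ) => (Matrix.of fun i j => fev w.1 w.2 (pderiv j (P i))).det) :=
        Continuous.matrix_det (continuous_matrix fun i j => fev_cont _)
      exact this.continuousAt.eventually_ne (hdet' x hx)
    filter_upwards [c1, c2, c3] with w w1 w2 w3 hw
    obtain ⟨g1, g2⟩ := (hPz w.1 w.2).1 hw
    refine (hZ w.1 w.2).2 ⟨⟨g1, fun e he => ?_⟩, w3, w1⟩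
    have hle : Ideal.span (Set.range f) ≤ RingHom.ker (eval (Hv w)) := by
      rw [Ideal.span_le]
      rintro _ ⟨b, rfl⟩
      exact g2 b
    have := hle (hgg e he)
    rw [RingHom.mem_ker, map_mul] at this
    exact (mul_eq_zero.1 this).resolve_left w2
  · intro O hO hRO
    refine tube 1 O hO fun x hx hxO hmem => hxO (hRO (hR x hx ?_))
    rwa [← hH1]
end
end

section
open Topology Filter MvPolynomial

section
variable {σ : Type} [Fintype σ]

noncomputable def dd (x v : σ → ℝ) (f : MvPolynomial σ ℝ) : ℝ := ∑ j, eval x (pderiv j f) * v j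

lemma dd_add (x v : σ → ℝ) (f g) : dd x v (f + g) = dd x v f + dd x v g := by
  simp only [dd, map_add, add_mul, Finset.sum_add_distrib]

lemma dd_sub (x v : σ → ℝ) (f g) : dd x v (f - g) = dd x v f - dd x v g := by
  simp only [dd, map_sub, sub_mul, Finset.sum_sub_distrib]

lemma dd_mul (x v : σ → ℝ) (f g) : dd x v (f * g) = dd x v f * eval x g + eval x f * dd x v g := by
  simp only [dd, Derivation.leibniz, smul_eq_mul, map_add, map_mul, Finset.mul_sum, Finset.sum_mul,
    ← Finset.sum_add_distrib]
  exact Finset.sum_congr rfl fun j _ => by ring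

lemma dd_C (x v : σ → ℝ) (c : ℝ) : dd x v (C c) = 0 := by simp [dd]

lemma dd_one (x v : σ → ℝ) : dd x v 1 = 0 := by simp [dd]

lemma dd_X (x v : σ → ℝ) (i : σ) : dd x v (X i) = v i := by
  classical
  simp only [dd, pderiv_X]
  rw [Finset.sum_eq_single i]
  · simp
  · intro b _ hb
    simp [Pi.single_apply, hb.symm]
  · simp

lemma dd_sum (x v : σ → ℝ) {ι : Type} (s : Finset ι) (f : ι → MvPolynomial σ ℝ) :
    dd x v (∑ i ∈ s, f i) = ∑ i ∈ s, dd x v (f i) := by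
  classical
  induction s using Finset.induction_on with
  | empty => simp [dd]
  | insert a s ha ih => rw [Finset.sum_insert ha, Finset.sum_insert ha, dd_add, ih]

lemma dd_rename {ι : Type} [Fintype ι] (r : ι → σ) (x v : σ → ℝ) (f : MvPolynomial ι ℝ) :
    dd x v (rename r f) = dd (x ∘ r) (v ∘ r) f := by
  induction f using MvPolynomial.induction_on with
  | C a => simp only [rename_C, dd_C]
  | add p q hp hq => simp only [map_add, dd_add, hp, hq]
  | mul_X p i hp => simp only [map_mul, rename_X, dd_mul, dd_X, hp, eval_X, eval_rename, Function.comp_apply]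
end

section
variable {n m : ℕ} {F : (Fin n → ℝ) → (Fin n → ℝ)} {p q : Fin n → MvPolynomial (Fin n) ℝ}

noncomputable def kpoly (a : Fin n → ℝ) (L : Matrix (Fin n) (Fin (m+1)) ℝ)
    (y : Fin (m+1) → MvPolynomial (Sg n m) ℝ) (i : Fin n) : MvPolynomial (Sg n m) ℝ :=
  C (a i) + ∑ j, C (L i j) * y j

lemma kpoly_eval (a : Fin n → ℝ) (L : Matrix (Fin n) (Fin (m+1)) ℝ)
    (y : Fin (m+1) → MvPolynomial (Sg n m) ℝ) (i : Fin n) (x) :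
    eval x (kpoly a L y i) = (a + L.mulVec (fun j => eval x (y j))) i := by
  simp [kpoly, Matrix.mulVec, dotProduct]

lemma kpoly_dd (a : Fin n → ℝ) (L : Matrix (Fin n) (Fin (m+1)) ℝ)
    (y : Fin (m+1) → MvPolynomial (Sg n m) ℝ) (i : Fin n) (x v) :
    dd x v (kpoly a L y i) = L.mulVec (fun j => dd x v (y j)) i := by
  simp [kpoly, Matrix.mulVec, dotProduct, dd_add, dd_sum, dd_mul, dd_C]

noncomputable def ellp (j : Fin (m+1)) : MvPolynomial (Sg n m) ℝ :=
  C (1/2) * ((1 - X (Sum.inr (Sum.inr 0))) * C ((Pi.single 0 1 : Fin (m+1) → ℝ) j) +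
    (1 + X (Sum.inr (Sum.inr 0))) * X (Sum.inr (Sum.inl j)))

lemma ellp_eval (x : Sg n m → ℝ) (j) : eval x (ellp j) = ell x j := by
  simp only [ellp, ell, vU, vE, map_mul, map_add, map_sub, eval_C, eval_X, map_one]; ring

noncomputable def geqs (p q : Fin n → MvPolynomial (Fin n) ℝ) (a : Fin n → ℝ)
    (L : Matrix (Fin n) (Fin (m+1)) ℝ) : Fin n ⊕ Fin 2 → MvPolynomial (Sg n m) ℝ :=
  Sum.elim (fun i => rename Sum.inl (p i) -
      kpoly a L (fun j => X (Sum.inr (Sum.inl j))) i * rename Sum.inl (q i))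
    ![∑ j, X (Sum.inr (Sum.inl j)) * X (Sum.inr (Sum.inl j)) - 1,
      X (Sum.inr (Sum.inr 0)) * X (Sum.inr (Sum.inr 0)) +
        X (Sum.inr (Sum.inr 1)) * X (Sum.inr (Sum.inr 1)) - 1]

lemma geqs_iff (hq : ∀ i x, eval x (q i) ≠ 0) (hF : ∀ x i, F x i = eval x (p i) / eval x (q i))
    (a : Fin n → ℝ) (L : Matrix (Fin n) (Fin (m+1)) ℝ) (x : Sg n m → ℝ) :
    (∀ i, eval x (geqs p q a L i) = 0) ↔ x ∈ Scfg F a L := by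
  have h1 : ∀ i, eval x (geqs p q a L (Sum.inl i)) = 0 ↔ F (vX x) i = (a + L.mulVec (vE x)) i := by
    intro i
    rw [← graph_iff hq hF]
    simp only [geqs, Sum.elim_inl, map_sub, map_mul, kpoly_eval, eval_rename, eval_X]
    rfl
  have h2 : eval x (geqs p q a L (Sum.inr 0)) = 0 ↔ ∑ j, vE x j ^ 2 = 1 := by
    simp [geqs, sub_eq_zero, vE, pow_two]
  have h3 : eval x (geqs p q a L (Sum.inr 1)) = 0 ↔ vU x ^ 2 + vV x ^ 2 = 1 := by
    simp [geqs, sub_eq_zero, vU, vV, pow_two]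
  constructor
  · intro h
    exact ⟨funext fun i => (h1 i).1 (h _), h2.1 (h _), h3.1 (h _)⟩
  · rintro ⟨g1, g2, g3⟩ (i | i)
    · exact (h1 i).2 (congrFun g1 i)
    · fin_cases i
      · exact h2.2 g2
      · exact h3.2 g3

lemma final_contra (hq : ∀ i x, eval x (q i) ≠ 0) (hF : ∀ x i, F x i = eval x (p i) / eval x (q i))
    (hjac : ∀ x, (fderiv ℝ F x).det ≠ 0)
    (hP : ∀ y ∈ Set.range F, ∃ K ∈ 𝓝 y, IsCompact K ∧ IsCompact (F ⁻¹' K))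
    (hA : IsClosed (Set.range F)ᶜ) (d : ℕ) (hd : Odd d)
    (hfib : ∀ y ∈ Set.range F, (F ⁻¹' {y}).Finite ∧ (F ⁻¹' {y}).ncard = d)
    (f : Fin (m+1) → MvPolynomial (Fin n) ℝ)
    (𝔭 : Ideal (MvPolynomial (Fin n) ℝ)) (hf : ∀ i, f i ∈ 𝔭) (Q : MvPolynomial (Fin n) ℝ)
    (hVA : ∀ y, (∀ e ∈ 𝔭, eval y e = 0) → eval y Q ≠ 0 → y ∈ (Set.range F)ᶜ)
    (a : Fin n → ℝ) (ha : ∀ e ∈ 𝔭, eval a e = 0) (hQa : eval a Q ≠ 0)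
    (gg : MvPolynomial (Fin n) ℝ) (hgga : eval a gg ≠ 0)
    (hgg : ∀ e ∈ 𝔭, gg * e ∈ Ideal.span (Set.range f))
    (L : Matrix (Fin n) (Fin (m+1)) ℝ) (ε : ℝ) (hε : ε ≠ 0)
    (hL : ∀ i v, ∑ k, eval a (pderiv k (f i)) * L.mulVec v k = ε * v i)
    (η : ℝ) (hη : 0 < η) (hch : ∀ (e : Fin (m+1) → ℝ) (r : Fin n → ℝ), ‖e‖ ≤ 1 → e ≠ 0 →
      ‖r‖ ≤ η * ‖e‖ → a + L.mulVec e + r ∉ (Set.range F)ᶜ) : False := by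
  classical
  have hFc : Continuous F := (rat_contDiff hq hF).continuous
  have hk : ∀ e : Fin (m+1) → ℝ, ∑ j, e j ^ 2 = 1 → a + L.mulVec e ∈ Set.range F := by
    intro e he
    have hn : ‖e‖ ≤ 1 := by
      rw [pi_norm_le_iff_of_nonneg zero_le_one]
      intro j
      have : e j ^ 2 ≤ ∑ j, e j ^ 2 :=
        Finset.single_le_sum (f := fun j => e j ^ 2) (fun j _ => sq_nonneg _) (Finset.mem_univ j)
      rw [Real.norm_eq_abs, abs_le]
      constructor <;> nlinarith
    have h0 : e ≠ 0 := by rintro rfl; simp at he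
    have := hch e 0 hn h0 (by rw [norm_zero]; positivity)
    rwa [add_zero, Set.notMem_compl_iff] at this
  have hs1 : ∑ j, (Pi.single 0 1 : Fin (m+1) → ℝ) j ^ 2 = 1 := by
    rw [Fin.sum_univ_succ]; simp
  have hs2 : ∑ j, (-Pi.single 0 1 : Fin (m+1) → ℝ) j ^ 2 = 1 := by
    simpa only [Pi.neg_apply, neg_sq] using hs1
  have hS : IsCompact (Scfg F a L) := Scfg_compact F hFc hP a L hk
  obtain ⟨x1, hx1⟩ := hk _ hs1
  obtain ⟨q', hq'⟩ := approx_map F hFc _ hA (fun x => by simp) a L η hη hch hS x1 hx1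
  obtain ⟨hfin, hcard⟩ := hfib _ (hk _ hs2)
  let mkv : (Fin n → ℝ) → (Sg n m → ℝ) := fun y => Sum.elim y (Sum.elim (-Pi.single 0 1) ![0, -1])
  have hmkinj : Function.Injective mkv := fun y y' h => by
    ext i; exact congrFun h (Sum.inl i)
  let R : Finset (Sg n m → ℝ) := hfin.toFinset.image mkv
  have hRc : R.card = d := by
    rw [Finset.card_image_of_injective _ hmkinj, ← hcard, Set.ncard_eq_toFinset_card _ hfin]
  have hRm : ∀ x, x ∈ R ↔ F (vX x) = a + L.mulVec (-Pi.single 0 1) ∧ vE x = -Pi.single 0 1 ∧ vU x = 0 ∧ vV x = -1 := by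
    intro x
    simp only [R, Finset.mem_image, Set.Finite.mem_toFinset, Set.mem_preimage, Set.mem_singleton_iff]
    constructor
    · rintro ⟨y, hy, rfl⟩
      exact ⟨hy, rfl, rfl, rfl⟩
    · rintro ⟨h1, h2, h3, h4⟩
      refine ⟨vX x, h1, ?_⟩
      ext s
      rcases s with i | j | k
      · rfl
      · exact (congrFun h2 j).symm
      · fin_cases k
        · exact h3.symm
        · exact h4.symm
  let h1 : Fin n → MvPolynomial (Sg n m) ℝ := fun k =>
    kpoly a L ellp k + (1 + X (Sum.inr (Sum.inr 1))) * ((1 + X (Sum.inr (Sum.inr 1))) * q' k)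
  have hh1 : ∀ x, (fun k => eval x (h1 k)) = (a + L.mulVec (ell x) + fun k => (1 + vV x) ^ 2 * eval x (q' k)) := by
    intro x
    ext k
    simp only [h1, map_add, kpoly_eval, ellp_eval, map_mul, map_one, eval_X, Pi.add_apply, vV]
    ring
  have hgi := geqs_iff (p := p) (q := q) (m := m) hq hF a L
  let eqv : Sg n m → (Fin n ⊕ Fin 2) ⊕ Fin (m+1) :=
    Sum.elim (fun i => Sum.inl (Sum.inl i)) (Sum.elim (fun j => Sum.inr j) (fun k => Sum.inl (Sum.inr k)))
  have heqv : Function.Surjective eqv := by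
    rintro ((i | k) | j)
    · exact ⟨Sum.inl i, rfl⟩
    · exact ⟨Sum.inr (Sum.inr k), rfl⟩
    · exact ⟨Sum.inr (Sum.inl j), rfl⟩
  have key := abs_parity eqv heqv (geqs p q a L) h1 f 𝔭 hf Q _ hA hVA (F 0) (by simp) a ha hQa gg hgga hgg
    (by
      have : {x : Sg n m → ℝ | ∀ i, eval x (geqs p q a L i) = 0} = Scfg F a L := Set.ext hgi
      rw [this]; exact hS) R ?_ ?_ ?_
  · rw [hRc] at key
    rcases hd with ⟨t, rfl⟩
    have : (2 * t + 1) % 2 = 0 % 2 := key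
    omega
  · intro x hx hmem
    rw [hh1] at hmem
    obtain ⟨g1, g2, g3⟩ := hq' x ((hgi x).1 hx) hmem
    refine (hRm x).2 ⟨?_, g1, g2, g3⟩
    rw [← g1]; exact ((hgi x).1 hx).1
  · intro x hx
    obtain ⟨g0, g1, g2, g3⟩ := (hRm x).1 hx
    refine ⟨(hgi x).2 ⟨by rw [g1]; exact g0, by rw [g1]; exact hs2, by rw [g2, g3]; norm_num⟩, ?_⟩
    rw [hh1]
    have : ell x = 0 := by
      ext j; simp only [ell, g1, g2, Pi.neg_apply, Pi.zero_apply]; ring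
    rw [this, g3]
    ext k; simp
  · intro x hx v hv1 hv2
    obtain ⟨g0, g1, g2, g3⟩ := (hRm x).1 hx
    have hv1' : ∀ i, dd x v (geqs p q a L i) = 0 := hv1
    have hv2' : ∀ b, ∑ k, eval a (pderiv k (f b)) * dd x v (h1 k) = 0 := hv2
    have k1 : vE v 0 = 0 := by
      have := hv1' (Sum.inr 0)
      simp only [geqs, Sum.elim_inr, Matrix.cons_val_zero, dd_sub, dd_sum, dd_mul, dd_X, dd_one, eval_X] at this
      have e : ∀ j : Fin (m+1), v (Sum.inr (Sum.inl j)) * x (Sum.inr (Sum.inl j)) +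
          x (Sum.inr (Sum.inl j)) * v (Sum.inr (Sum.inl j)) = 2 * vE v j * vE x j := by
        intro j; simp only [vE]; ring
      simp only [e, g1] at this
      rw [Fin.sum_univ_succ] at this
      simp at this
      exact this
    have k2 : vV v = 0 := by
      have := hv1' (Sum.inr 1)
      have e1 : x (Sum.inr (Sum.inr 0)) = 0 := g2
      have e2 : x (Sum.inr (Sum.inr 1)) = -1 := g3
      simp only [geqs, Sum.elim_inr, Matrix.cons_val_one, Matrix.cons_val_zero, dd_sub, dd_add, dd_mul, dd_X, dd_one, eval_X, e1, e2] at this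
      simp only [vV]
      linarith
    have k3 : ∀ k, dd x v (h1 k) = L.mulVec (fun j => dd x v (ellp j)) k := by
      intro k
      have e2 : x (Sum.inr (Sum.inr 1)) = -1 := g3
      simp only [h1, dd_add, kpoly_dd, dd_mul, dd_one, dd_X, map_add, map_one, eval_X, e2, map_mul]
      ring
    have k4 : ∀ j, dd x v (ellp j) = 0 := by
      intro j
      have := hv2' j
      simp only [k3, hL] at this
      exact (mul_eq_zero.1 this).resolve_left hε
    have k5 : ∀ j, - (2 * vU v) * (Pi.single 0 1 : Fin (m+1) → ℝ) j + vE v j = 0 := by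
      intro j
      have := k4 j
      have e1 : x (Sum.inr (Sum.inr 0)) = 0 := g2
      have e2 : x (Sum.inr (Sum.inl j)) = -(Pi.single 0 1 : Fin (m+1) → ℝ) j := congrFun g1 j
      simp only [ellp, dd_mul, dd_C, dd_add, dd_sub, dd_one, dd_X, eval_X, eval_C, map_add, map_sub, map_one, e1, e2] at this
      simp only [vU, vE]
      linarith
    have k6 : vU v = 0 := by
      have := k5 0
      rw [k1, Pi.single_eq_same] at this
      linarith
    have k7 : ∀ j, vE v j = 0 := by
      intro j
      have := k5 j
      rw [k6] at this
      linarith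
    have k8 : vX v = 0 := by
      by_contra hne
      refine graph_det hq hF hjac (vX x) (Matrix.exists_mulVec_eq_zero_iff.1 ⟨vX v, hne, ?_⟩)
      ext i
      have h := hv1' (Sum.inl i)
      simp only [geqs, Sum.elim_inl, dd_sub, dd_mul, kpoly_dd, kpoly_eval, dd_rename, dd_X, eval_X, eval_rename] at h
      have e1 : (fun j => v (Sum.inr (Sum.inl j))) = (0 : Fin (m+1) → ℝ) := funext k7
      have e2 : (fun j => x (Sum.inr (Sum.inl j))) = (-Pi.single 0 1 : Fin (m+1) → ℝ) := g1
      have e3 : x ∘ Sum.inl = vX x := rfl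
      have e4 : v ∘ Sum.inl = vX v := rfl
      rw [e1, e2, e3, e4, ← g0, Matrix.mulVec_zero] at h
      simp only [dd, Pi.zero_apply, zero_mul, zero_add, Finset.mul_sum, ← Finset.sum_sub_distrib] at h
      simp only [Matrix.mulVec, dotProduct, Matrix.of_apply, Pi.zero_apply]
      rw [← h]
      exact Finset.sum_congr rfl fun j _ => by ring
    ext s
    rcases s with i | j | k
    · exact congrFun k8 i
    · exact k7 j
    · fin_cases k
      · exact k6
      · exact k2
end
end

section
open Topology Filter MvPolynomial

lemma rat_localHomeo {n : ℕ} {F : (Fin n → ℝ) → (Fin n → ℝ)} (hc : ContDiff ℝ 1 F)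
    (hjac : ∀ x, (fderiv ℝ F x).det ≠ 0) : IsLocalHomeomorph F := by
  refine IsLocalHomeomorph.mk F fun x => ?_
  let e := ContinuousLinearMap.toContinuousLinearEquivOfDetNeZero (fderiv ℝ F x) (hjac x)
  have hs : HasStrictFDerivAt F (e : (Fin n → ℝ) →L[ℝ] (Fin n → ℝ)) x := by
    rw [ContinuousLinearMap.coe_toContinuousLinearEquivOfDetNeZero]
    exact hc.contDiffAt.hasStrictFDerivAt one_ne_zero
  exact ⟨hs.toOpenPartialHomeomorph F, hs.mem_toOpenPartialHomeomorph_source, fun y _ => rfl⟩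

lemma hard_claim {n : ℕ} {F : (Fin n → ℝ) → (Fin n → ℝ)} {p q : Fin n → MvPolynomial (Fin n) ℝ}
    (hq : ∀ i x, eval x (q i) ≠ 0) (hF : ∀ x i, F x i = eval x (p i) / eval x (q i))
    (hjac : ∀ x, (fderiv ℝ F x).det ≠ 0) (hdense : Dense (Set.range F)) (hns : ¬ Function.Surjective F)
    (hP : ∀ y ∈ Set.range F, ∃ K ∈ 𝓝 y, IsCompact K ∧ IsCompact (F ⁻¹' K)) : False := by
  classical
  have hc := rat_contDiff hq hF
  have hLH := rat_localHomeo hc hjac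
  have hA : IsClosed (Set.range F)ᶜ := hLH.isOpenMap.isOpen_range.isClosed_compl
  obtain ⟨d, hd, hfib⟩ := fibre_odd hLH hP
  have hne : ((Set.range F)ᶜ).Nonempty := by
    rw [Set.nonempty_compl]
    exact fun h => hns (Set.range_eq_univ.1 h)
  obtain ⟨𝔭, hprime, O, hO, hAO, hex⟩ := local_prime _ hne
  obtain ⟨Q, hQ, D, hD⟩ := fibre_parity hq hF hjac 𝔭
  obtain ⟨m, f, N, h, g, hf, hh, hg, hN, hgg⟩ := smooth_data 𝔭
  obtain ⟨a, ⟨haA, haO⟩, hae⟩ := hex (Q * h * g) (fun hm => by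
    rcases hprime.mem_or_mem hm with h1 | h1
    · rcases hprime.mem_or_mem h1 with h2 | h2
      · exact hQ h2
      · exact hh h2
    · exact hg h1)
  rw [map_mul, map_mul] at hae
  have hga := right_ne_zero_of_mul hae
  have hha := right_ne_zero_of_mul (left_ne_zero_of_mul hae)
  have hQa := left_ne_zero_of_mul (left_ne_zero_of_mul hae)
  have haV := hAO a ⟨haA, haO⟩
  have hD0 : 0 ≡ D [MOD 2] := by
    have h1 := hD a haV hQa
    have h2 : F ⁻¹' {a} = ∅ := by
      ext x; simp only [Set.mem_preimage, Set.mem_singleton_iff, Set.mem_empty_iff_false, iff_false]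
      exact fun hx => haA ⟨x, hx⟩
    rwa [h2, Set.ncard_empty] at h1
  have hVA : ∀ y, (∀ e ∈ 𝔭, eval y e = 0) → eval y Q ≠ 0 → y ∈ (Set.range F)ᶜ := by
    intro y hy hyQ hyr
    have h1 := hD y hy hyQ
    rw [(hfib y hyr).2] at h1
    have h2 : d % 2 = 0 % 2 := h1.trans hD0.symm
    rcases hd with ⟨t, rfl⟩
    omega
  cases m with
  | zero =>
    have hbot : ∀ e ∈ 𝔭, e = 0 := by
      intro e he
      have h1 := hgg e he
      rw [Set.range_eq_empty, Ideal.span_empty, Ideal.mem_bot] at h1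
      refine (mul_eq_zero.1 h1).resolve_left ?_
      rintro rfl
      exact hg 𝔭.zero_mem
    have hop : IsOpen {y | eval y Q ≠ 0} := isOpen_ne_fun (continuous_eval Q) continuous_const
    obtain ⟨y, hy1, hy2⟩ := hdense.inter_open_nonempty _ hop ⟨a, hQa⟩
    exact hVA y (fun e he => by rw [hbot e he, map_zero]) hy1 hy2
  | succ m =>
    let ν : Matrix (Fin n) (Fin (m+1)) ℝ := Matrix.of fun k j => eval a (N k j) / eval a h
    have hν : ∀ i j, ∑ k, eval a (pderiv k (f i)) * ν k j = if i = j then 1 else 0 := by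
      intro i j
      have h1 := haV _ (hN i j)
      rw [map_sub, map_sum, sub_eq_zero] at h1
      simp only [map_mul] at h1
      have h2 : ∀ k, eval a (pderiv k (f i)) * ν k j = eval a (pderiv k (f i)) * eval a (N k j) / eval a h :=
        fun k => by simp only [ν, Matrix.of_apply, mul_div_assoc]
      simp only [h2, ← Finset.sum_div, h1]
      split_ifs
      · exact div_self hha
      · simp
    obtain ⟨ε, hε, η, hη, hch⟩ := chart_lemma _ O hO a haO f (fun y hy i => hAO y hy _ (hf i))
      (fun i => haV _ (hf i)) ν hν
    refine final_contra hq hF hjac hP hA d hd hfib f 𝔭 hf Q hVA a haV hQa g hga hgg (ε • ν) ε hε.ne' ?_ η hη hch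
    intro i v
    rw [Matrix.smul_mulVec]
    simp only [Pi.smul_apply, smul_eq_mul, Matrix.mulVec, dotProduct, Finset.mul_sum]
    rw [Finset.sum_comm]
    have h3 : ∀ j, ∑ k, eval a (pderiv k (f i)) * (ε * (ν k j * v j)) =
        ε * v j * (if i = j then 1 else 0) := by
      intro j
      rw [← hν i j, Finset.mul_sum]
      exact Finset.sum_congr rfl fun k _ => by ring
    simp only [h3]
    simp
end

open Topology Filter MvPolynomial

/-- For an everywhere defined real rational map `F : ℝⁿ → ℝⁿ` with nowhere
vanishing Jacobian determinant, `A(F)` the nonproperness set and `B(F) = F⁻¹(A(F))`: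
`F` has dense image iff the coimage `ℝⁿ \ F(ℝⁿ)` is contained in `A(F)`; in that case
`A(F)` is the disjoint union of the coimage and `F(B(F))`; and if `F` has dense image but
is not surjective then both pieces are nonempty, so the coimage is a nonempty closed
proper subset of `A(F)`. -/
theorem dense_image_coimage_RRJC
    (n : ℕ) (F : (Fin n → ℝ) → (Fin n → ℝ))
    (hF : IsEverywhereDefRatMap n F)
    (hjac : ∀ x : Fin n → ℝ, (fderiv ℝ F x).det ≠ 0)
    (AF BF : Set (Fin n → ℝ))
    (hAF : AF = {y | ¬ ProperAt n F y}) (hBF : BF = F ⁻¹' AF) :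
    (Dense (Set.range F) ↔ (Set.range F)ᶜ ⊆ AF) ∧
    (Dense (Set.range F) →
      AF = (Set.range F)ᶜ ∪ F '' BF ∧ Disjoint ((Set.range F)ᶜ) (F '' BF)) ∧
    (Dense (Set.range F) → ¬ Function.Surjective F →
      ((Set.range F)ᶜ).Nonempty ∧ (F '' BF).Nonempty ∧
      IsClosed ((Set.range F)ᶜ) ∧ (Set.range F)ᶜ ⊂ AF) := by
  choose p q hq hpq using hF
  have hF' : ∀ x i, F x i = eval x (p i) / eval x (q i) := fun x i => hpq i x
  have hc := rat_contDiff hq hF'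
  have hFc : Continuous F := hc.continuous
  have hLH := rat_localHomeo hc hjac
  have hA : IsClosed (Set.range F)ᶜ := hLH.isOpenMap.isOpen_range.isClosed_compl
  have h1 : Dense (Set.range F) ↔ (Set.range F)ᶜ ⊆ AF := by
    constructor
    · intro hd y hy
      rw [hAF]
      rintro ⟨K, hK, -, hFK⟩
      apply hy
      have hcl : IsClosed (F '' (F ⁻¹' K)) := (hFK.image hFc).isClosed
      have hy2 : y ∈ closure (F '' (F ⁻¹' K)) := by
        rw [mem_closure_iff_nhds]
        intro t ht
        obtain ⟨z, hz, hzr⟩ := mem_closure_iff_nhds.1 (hd y) (t ∩ K) (inter_mem ht hK)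
        obtain ⟨x, rfl⟩ := hzr
        exact ⟨F x, hz.1, x, hz.2, rfl⟩
      rw [hcl.closure_eq] at hy2
      obtain ⟨x, -, hx⟩ := hy2
      exact ⟨x, hx⟩
    · intro hsub y
      by_contra hy
      have hyo : (closure (Set.range F))ᶜ ∈ 𝓝 y := isClosed_closure.isOpen_compl.mem_nhds hy
      obtain ⟨K, hKn, hKs, hKc⟩ := local_compact_nhds hyo
      have hyA : y ∈ AF := hsub fun h => hy (subset_closure h)
      rw [hAF] at hyA
      apply hyA
      refine ⟨K, hKn, hKc, ?_⟩
      have : F ⁻¹' K = ∅ := by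
        ext x
        simp only [Set.mem_preimage, Set.mem_empty_iff_false, iff_false]
        exact fun hx => hKs hx (subset_closure ⟨x, rfl⟩)
      rw [this]; exact isCompact_empty
  have h2 : Dense (Set.range F) →
      AF = (Set.range F)ᶜ ∪ F '' BF ∧ Disjoint ((Set.range F)ᶜ) (F '' BF) := by
    intro hd
    have hs := h1.1 hd
    refine ⟨?_, ?_⟩
    · ext y
      constructor
      · intro hy
        by_cases hr : y ∈ Set.range F
        · obtain ⟨x, rfl⟩ := hr
          exact Or.inr ⟨x, by rw [hBF]; exact hy, rfl⟩
        · exact Or.inl hr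
      · rintro (hy | ⟨x, hx, rfl⟩)
        · exact hs hy
        · rw [hBF] at hx; exact hx
    · rw [Set.disjoint_left]
      rintro _ hy ⟨x, -, rfl⟩
      exact hy ⟨x, rfl⟩
  refine ⟨h1, h2, fun hd hns => ?_⟩
  have hne : ((Set.range F)ᶜ).Nonempty := by
    rw [Set.nonempty_compl]
    exact fun h => hns (Set.range_eq_univ.1 h)
  have hB : (F '' BF).Nonempty := by
    by_contra hcon
    refine hard_claim hq hF' hjac hd hns ?_
    rintro _ ⟨x, rfl⟩
    by_contra hnp
    apply hcon
    refine ⟨F x, x, ?_, rfl⟩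
    rw [hBF, hAF]
    rintro ⟨K, hK1, hK2, hK3⟩
    exact hnp ⟨K, hK1, hK2, hK3⟩
  refine ⟨hne, hB, hA, h1.1 hd, fun hsub => ?_⟩
  obtain ⟨y, hy⟩ := hB
  have hyA : y ∈ AF := by rw [(h2 hd).1]; exact Or.inr hy
  exact Set.disjoint_left.1 (h2 hd).2 (hsub hyA) hy
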